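/- arXiv:1206.0271 — 2 statements merged into one kernel-verified Lean document; each statement's English description precedes it below -/
import Mathlib

section
/- Let G = Z/2 act antipodally on the sphere Sⁿ with n ≥ 1 odd. Then the equivariant topological complexity TC_G(Sⁿ) equals 1 (in reduced convention). -/
noncomputable section

open unitInterval Set

/-- The double evaluation map `X^{[0,1]} → X × X`, sending a path `γ : [0,1] → X`
to the pair of its endpoints `(γ(0), γ(1))`. -/
def pathEval (X : Type*) [TopologicalSpace X] (γ : C(I, X)) : X × X := (γ 0, γ 1)

/-- `X × X` admits a cover by `k + 1` open sets on each of which the double evaluation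
map `X^{[0,1]} → X × X` admits a continuous section. -/
def TCCover (X : Type*) [TopologicalSpace X] (k : ℕ) : Prop :=
  ∃ U : Fin (k + 1) → Set (X × X),
    (∀ i, IsOpen (U i)) ∧ (⋃ i, U i) = Set.univ ∧
    ∀ i, ∃ s : C(U i, C(I, X)), ∀ u : U i, pathEval X (s u) = (u : X × X)

/-- Farber's (reduced) topological complexity, as an element of `ℕ∞`. -/
def topComplexity (X : Type*) [TopologicalSpace X] : ℕ∞ :=
  sInf {c : ℕ∞ | ∃ k : ℕ, TCCover X k ∧ c = k}

/-- `X × X` admits a cover by `k + 1` `G`-invariant open sets (for the diagonal `G`-action)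
on each of which the double evaluation map admits a continuous `G`-equivariant section. -/
def EqTCCover (G X : Type*) [Group G] [TopologicalSpace X] [MulAction G X] (k : ℕ) : Prop :=
  ∃ U : Fin (k + 1) → Set (X × X),
    (∀ i, IsOpen (U i)) ∧ (⋃ i, U i) = Set.univ ∧
    (∀ i (g : G) p, p ∈ U i → g • p ∈ U i) ∧
    ∀ i, ∃ s : C(U i, C(I, X)),
      (∀ u : U i, pathEval X (s u) = (u : X × X)) ∧
      ∀ (g : G) (u : U i) (hg : g • (u : X × X) ∈ U i) (t : I),
        (s ⟨g • (u : X × X), hg⟩) t = g • (s u) t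

/-- The (reduced) equivariant topological complexity `TC_G(X)` of Colman–Grant,
as an element of `ℕ∞`. -/
def eqTC (G X : Type*) [Group G] [TopologicalSpace X] [MulAction G X] : ℕ∞ :=
  sInf {c : ℕ∞ | ∃ k : ℕ, EqTCCover G X k ∧ c = k}

/-- The antipodal `ℤ/2`-action (modelled on the group `ℤˣ = {±1}`) on the unit sphere
`Sⁿ ⊆ ℝ^{n+1}`: the generator acts by the antipodal map `x ↦ -x`. -/
instance sphereAntipodalSMul (n : ℕ) :
    SMul ℤˣ (Metric.sphere (0 : EuclideanSpace ℝ (Fin (n + 1))) 1) :=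
  ⟨fun g x => ⟨((g : ℤ) : ℝ) • (x : EuclideanSpace ℝ (Fin (n + 1))), by
    have hx := x.2
    have hg : |((g : ℤ) : ℝ)| = 1 := by
      rcases Int.units_eq_one_or g with h | h <;> simp [h]
    simp only [mem_sphere_iff_norm, sub_zero, norm_smul, Real.norm_eq_abs, hg,
      one_mul] at *
    exact hx⟩⟩

instance sphereAntipodalAction (n : ℕ) :
    MulAction ℤˣ (Metric.sphere (0 : EuclideanSpace ℝ (Fin (n + 1))) 1) where
  one_smul x := by
    apply Subtype.ext
    show (((1 : ℤˣ) : ℤ) : ℝ) • (x : EuclideanSpace ℝ (Fin (n + 1))) = x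
    simp
  mul_smul g h x := by
    apply Subtype.ext
    show (((g * h : ℤˣ) : ℤ) : ℝ) • (x : EuclideanSpace ℝ (Fin (n + 1))) =
      ((g : ℤ) : ℝ) • (((h : ℤ) : ℝ) • (x : EuclideanSpace ℝ (Fin (n + 1))))
    push_cast
    rw [smul_smul]

/-- `t ↦ det (1 + t A)` is a polynomial of degree at most `dim E`, hence is recovered from its
values at any `dim E + 1` nodes by Lagrange interpolation. -/
theorem det_one_add_smul_eq_sum_lagrange {E : Type*} [NormedAddCommGroup E] [NormedSpace ℝ E]
    [FiniteDimensional ℝ E] {s : Finset ℝ} (hs : Module.finrank ℝ E < s.card)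
    (A : E →L[ℝ] E) (t : ℝ) :
    (1 + t • A).det = ∑ i ∈ s, (Lagrange.basis s id i).eval t * (1 + i • A).det := by
  classical
  let b := Module.finBasis ℝ E
  let M := LinearMap.toMatrix b b (A : E →ₗ[ℝ] E)
  let p : Polynomial ℝ :=
    Matrix.det ((Polynomial.X : Polynomial ℝ) • M.map Polynomial.C +
      (1 : Matrix _ _ ℝ).map Polynomial.C)
  have hp : ∀ u : ℝ, p.eval u = (1 + u • A).det := fun u => by
    rw [ContinuousLinearMap.det, ← LinearMap.det_toMatrix b, ← Polynomial.coe_evalRingHom,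
      RingHom.map_det]
    congr 1
    ext i j
    simp [M, Matrix.one_apply, add_comm, mul_comm u, apply_ite, LinearMap.toMatrix_apply,
      Finsupp.single_apply, eq_comm]
  have hdeg : p.degree < s.card := by
    refine lt_of_le_of_lt (Polynomial.degree_le_of_natDegree_le
      (Polynomial.natDegree_det_X_add_C_le M 1)) ?_
    rw [Fintype.card_fin]
    exact_mod_cast hs
  rw [← hp]
  conv_lhs => rw [Lagrange.eq_interpolate (s := s) (v := id) Function.injective_id.injOn hdeg]
  simp [Lagrange.interpolate_apply, Polynomial.eval_finsetSum, hp, mul_comm]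

theorem det_one_add_pos {E : Type*} [NormedAddCommGroup E] [NormedSpace ℝ E]
    [FiniteDimensional ℝ E] {A : E →L[ℝ] E} (hA : ‖A‖ < 1) : 0 < (1 + A).det := by
  have hne : ∀ t ∈ Icc (0 : ℝ) 1, (1 + t • A).det ≠ 0 := by
    intro t ht h0
    obtain ⟨v, hv, hv0⟩ := (Submodule.ne_bot_iff _).1
      (LinearMap.bot_lt_ker_of_det_eq_zero h0).ne'
    have hv' : v = -(t • A v) := by
      rw [LinearMap.mem_ker] at hv
      exact eq_neg_of_add_eq_zero_left (by simpa using hv)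
    have h1 : ‖v‖ ≤ ‖A‖ * ‖v‖ := by
      calc ‖v‖ = t * ‖A v‖ := by
            conv_lhs => rw [hv', norm_neg, norm_smul, Real.norm_of_nonneg ht.1]
        _ ≤ 1 * ‖A v‖ := by gcongr; exact ht.2
        _ ≤ _ := by rw [one_mul]; exact A.le_opNorm v
    have := norm_pos_iff.2 hv0
    nlinarith
  have hc : Continuous fun t : ℝ => (1 + t • A).det :=
    ContinuousLinearMap.continuous_det.comp (by fun_prop)
  by_contra! h
  obtain ⟨t, ht, h0⟩ := intermediate_value_Icc' zero_le_one hc.continuousOn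
    (show (0 : ℝ) ∈ Icc _ _ by simpa [ContinuousLinearMap.det] using h)
  exact hne t ht h0

/-- A function that is Lipschitz on a closed set and vanishes on its frontier remains Lipschitz,
with the same constant, when extended by zero. -/
theorem lipschitzWith_indicator {E F : Type*} [NormedAddCommGroup E] [NormedSpace ℝ E]
    [NormedAddCommGroup F] {s : Set E} {f : E → F} {K : NNReal}
    (hf : LipschitzOnWith K f s) (hs : IsClosed s) (h0 : ∀ x ∈ frontier s, f x = 0) :
    LipschitzWith K (s.indicator f) := by
  have key : ∀ x ∈ s, ∀ y ∉ s, ‖f x‖ ≤ K * dist x y := by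
    intro x hx y hy
    obtain ⟨z, hz, hzs⟩ : ∃ z ∈ segment ℝ x y, z ∈ frontier s := by
      by_contra! h
      have hmem_int : ∀ z ∈ segment ℝ x y, z ∈ s → z ∈ interior s := fun z hz hzs => by
        by_contra hzi
        exact h z hz (hs.frontier_eq ▸ ⟨hzs, hzi⟩)
      obtain ⟨z, -, hzi, hzs⟩ := (convex_segment (𝕜 := ℝ) x y).isPreconnected (interior s) sᶜ
        isOpen_interior hs.isOpen_compl
        (fun z hz => (em (z ∈ s)).imp (hmem_int z hz) id)
        ⟨x, left_mem_segment ℝ x y, hmem_int x (left_mem_segment ℝ x y) hx⟩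
        ⟨y, right_mem_segment ℝ x y, hy⟩
      exact hzs (interior_subset hzi)
    have h1 := hf.dist_le_mul x hx z (hs.frontier_subset hzs)
    rw [h0 z hzs, dist_zero_right] at h1
    refine h1.trans (mul_le_mul_of_nonneg_left ?_ K.2)
    rw [← dist_add_dist_of_mem_segment hz]
    linarith [dist_nonneg (x := z) (y := y)]
  refine LipschitzWith.of_dist_le_mul fun x y => ?_
  by_cases hx : x ∈ s <;> by_cases hy : y ∈ s
  · simpa [hx, hy] using hf.dist_le_mul x hx y hy
  · simpa [hx, hy] using key x hx y hy
  · simpa [hx, hy, dist_comm] using key y hy x hx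
  · simp only [hx, hy, not_false_eq_true, indicator_of_notMem, dist_self]; positivity

/-- A small multiple of a Lipschitz vector field on a ball that vanishes on the bounding sphere
perturbs the identity to a bijection of the ball. -/
theorem image_add_smul_closedBall {E : Type*} [NormedAddCommGroup E] [NormedSpace ℝ E]
    [CompleteSpace E]
    {g : E → E} {R : ℝ} {K : NNReal}
    (hg : LipschitzOnWith K g (Metric.closedBall 0 R)) (h0 : ∀ x, ‖x‖ = R → g x = 0)
    (hR : R ≠ 0) (hgR : ∀ x ∈ Metric.closedBall 0 R, ‖x + g x‖ ≤ R) {t : NNReal} (ht : t ≤ 1)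
    (htK : t * K < 1) :
    InjOn (fun x => x + (t : ℝ) • g x) (Metric.closedBall 0 R) ∧
      (fun x => x + (t : ℝ) • g x) '' Metric.closedBall 0 R = Metric.closedBall 0 R := by
  set B := Metric.closedBall (0 : E) R
  have hG : LipschitzWith K (B.indicator g) :=
    lipschitzWith_indicator hg Metric.isClosed_closedBall fun x hx =>
      h0 x (by simpa [B, frontier_closedBall _ hR] using hx)
  let f : E → E := fun x => x + (t : ℝ) • B.indicator g x
  have hfB : EqOn (fun x => x + (t : ℝ) • g x) f B := fun x hx => by simp [f, hx]
  have hf : ApproximatesLinearOn f ((ContinuousLinearEquiv.refl ℝ E : E ≃L[ℝ] E) : E →L[ℝ] E) univ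
      (t * K) := by
    intro x _ y _
    have : f x - f y - ((ContinuousLinearEquiv.refl ℝ E : E ≃L[ℝ] E) : E →L[ℝ] E) (x - y) =
        (t : ℝ) • (B.indicator g x - B.indicator g y) := by
      simp only [f, ContinuousLinearEquiv.coe_refl, ContinuousLinearMap.id_apply, smul_sub]
      abel
    rw [this, norm_smul, Real.norm_of_nonneg t.coe_nonneg, NNReal.coe_mul, mul_assoc]
    exact mul_le_mul_of_nonneg_left (by simpa only [dist_eq_norm] using hG.dist_le_mul x y)
      t.coe_nonneg
  have hc : Subsingleton E ∨ t * K <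
      ‖((ContinuousLinearEquiv.refl ℝ E : E ≃L[ℝ] E).symm : E →L[ℝ] E)‖₊⁻¹ := by
    rcases subsingleton_or_nontrivial E with h | h
    · exact Or.inl h
    · right
      simpa using htK
  refine ⟨hfB.injOn_iff.2 ((hf.injOn hc).mono (subset_univ _)), ?_⟩
  rw [hfB.image_eq]
  apply Subset.antisymm
  · rintro _ ⟨x, hx, rfl⟩
    rw [← hfB hx]
    have hx' : ‖x‖ ≤ R := by simpa [B] using hx
    have ht' : (t : ℝ) ≤ 1 := ht
    have : x + (t : ℝ) • g x = (1 - t : ℝ) • x + (t : ℝ) • (x + g x) := by module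
    simp only [this, B, mem_closedBall_zero_iff]
    calc _ ≤ (1 - t : ℝ) * ‖x‖ + t * ‖x + g x‖ := by
          refine (norm_add_le _ _).trans_eq ?_
          rw [norm_smul, norm_smul, Real.norm_of_nonneg t.coe_nonneg,
            Real.norm_of_nonneg (sub_nonneg.2 ht')]
      _ ≤ (1 - t) * R + t * R := by
          have := hgR x hx
          have := sub_nonneg.2 ht'
          gcongr
      _ = R := by ring
  · intro y hy
    obtain ⟨x, rfl⟩ := hf.surjective hc y
    refine ⟨x, ?_, rfl⟩
    by_contra hx
    simp [f, hx] at hy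

/-- There is no `C¹` map onto a sphere that fixes the sphere pointwise (Milnor and Rogers): the
volume of the image of the ball under `id + t (r - id)` is polynomial in `t`, constant for small `t`,
and would vanish at `t = 1`. -/
theorem not_contDiff_retraction_sphere {E : Type*} [NormedAddCommGroup E] [InnerProductSpace ℝ E]
    [FiniteDimensional ℝ E] {r : E → E} {R : ℝ} (hR : 0 < R) (hr : ContDiff ℝ 1 r)
    (hnorm : ∀ x, ‖r x‖ = R) (hfix : ∀ x, ‖x‖ = R → r x = x) : False := by
  borelize E
  let μ : MeasureTheory.Measure E := MeasureTheory.Measure.addHaar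
  set B := Metric.closedBall (0 : E) R with hB
  let A : E → E →L[ℝ] E := fun x => fderiv ℝ r x - 1
  have hAc : Continuous A := (hr.continuous_fderiv (by norm_num)).sub continuous_const
  have hA : ∀ x, HasFDerivAt (fun x => r x - x) (A x) x := fun x =>
    ((hr.differentiable (by norm_num)) x).hasFDerivAt.sub (hasFDerivAt_id x)
  have hBc : IsCompact B := isCompact_closedBall 0 R
  obtain ⟨M, hM⟩ := hBc.exists_bound_of_continuousOn hAc.continuousOn
  have hM0 : 0 ≤ M := (norm_nonneg _).trans (hM 0 (by simp [hB, hR.le]))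
  lift M to NNReal using hM0
  have hlip : LipschitzOnWith M (fun x => r x - x) B :=
    Convex.lipschitzOnWith_of_nnnorm_hasFDerivWithin_le (𝕜 := ℝ)
      (fun x _ => (hA x).hasFDerivWithinAt) (fun x hx => hM x hx) (convex_closedBall 0 R)
  have hsmall : ∀ t ∈ Ico (0 : ℝ) (1 / (M + 1)), ∫ x in B, (1 + t • A x).det ∂μ = μ.real B := by
    intro t ht
    have hM1 : (0 : ℝ) < M + 1 := by positivity
    have htM : t * (M + 1) < 1 := (lt_div_iff₀ hM1).1 ht.2
    have ht1 : t ≤ 1 := by nlinarith [ht.1, M.2]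
    have htK : t * M < 1 := by nlinarith [ht.1]
    obtain ⟨hinj, himg⟩ : InjOn (fun x => x + t • (r x - x)) B ∧
        (fun x => x + t • (r x - x)) '' B = B :=
      image_add_smul_closedBall hlip (fun x hx => by simp [hfix x hx]) hR.ne'
      (fun x _ => by simp [hnorm]) (t := ⟨t, ht.1⟩) ht1 htK
    have h := MeasureTheory.integral_image_eq_integral_abs_det_fderiv_smul μ
      (f := fun x => x + t • (r x - x)) (f' := fun x => 1 + t • A x) hBc.measurableSet
      (fun x _ => ((hasFDerivAt_id x).add ((hA x).const_smul t)).hasFDerivWithinAt)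
      hinj (fun _ => (1 : ℝ))
    rw [himg] at h
    simp only [MeasureTheory.integral_const, smul_eq_mul, mul_one,
      MeasureTheory.measureReal_restrict_apply_univ] at h
    rw [h]
    refine MeasureTheory.setIntegral_congr_fun hBc.measurableSet fun x hx => ?_
    refine (abs_of_pos (det_one_add_pos ?_)).symm
    rw [norm_smul, Real.norm_of_nonneg ht.1]
    exact (mul_le_mul_of_nonneg_left (hM x hx) ht.1).trans_lt htK
  obtain ⟨s, hs, hcard⟩ :=
    (Ico_infinite (show (0 : ℝ) < 1 / (M + 1) by positivity)).exists_subset_card_eq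
      (Module.finrank ℝ E + 1)
  have hdet_int : ∀ t : ℝ, MeasureTheory.IntegrableOn (fun x => (1 + t • A x).det) B μ := fun t =>
    (ContinuousLinearMap.continuous_det.comp (by fun_prop)).continuousOn.integrableOn_compact hBc
  have hone : ∫ x in B, (1 + (1 : ℝ) • A x).det ∂μ = μ.real B := by
    simp_rw [fun x => det_one_add_smul_eq_sum_lagrange (s := s) (by omega) (A x) 1]
    rw [MeasureTheory.integral_finsetSum _ fun i _ => (hdet_int i).const_mul _]
    simp_rw [MeasureTheory.integral_const_mul]
    rw [Finset.sum_congr rfl fun i hi => by rw [hsmall i (hs hi)], ← Finset.sum_mul,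
      ← Polynomial.eval_finsetSum, Lagrange.sum_basis Function.injective_id.injOn
        (Finset.card_pos.1 (by omega))]
    simp
  have hzero : ∀ x, (1 + (1 : ℝ) • A x).det = 0 := by
    intro x
    have hAx : 1 + (1 : ℝ) • A x = fderiv ℝ r x := by simp [A]
    have hrx := ((hr.differentiable (by norm_num)) x).hasFDerivAt
    have horth : ∀ v, inner ℝ (r x) (fderiv ℝ r x v) = 0 := by
      intro v
      have h1 := hrx.norm_sq
      have h2 : HasFDerivAt (fun x => ‖r x‖ ^ 2) (0 : E →L[ℝ] ℝ) x := by
        simp only [hnorm]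
        exact hasFDerivAt_const _ _
      simpa using congrArg (fun L : E →L[ℝ] ℝ => L v) (h1.unique h2)
    rw [hAx]
    by_contra hdet
    obtain ⟨v, hv⟩ :=
      ((fderiv ℝ r x).toContinuousLinearEquivOfDetNeZero hdet).surjective (r x)
    have := horth v
    rw [show fderiv ℝ r x v = r x from hv, real_inner_self_eq_norm_sq, hnorm] at this
    exact hR.ne' (by simpa using this)
  simp only [hzero, MeasureTheory.integral_zero] at hone
  have hpos : 0 < μ.real B :=
    ENNReal.toReal_pos (Metric.measure_closedBall_pos μ 0 hR).ne' hBc.measure_ne_top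
  exact hpos.ne hone

/-- There is no continuous map onto the unit sphere that is radial projection outside the unit
ball. -/
theorem not_continuous_retraction_sphere {E : Type*} [NormedAddCommGroup E]
    [InnerProductSpace ℝ E] [FiniteDimensional ℝ E] {F : E → E} (hF : Continuous F)
    (hnorm : ∀ x, ‖F x‖ = 1) (hfix : ∀ x, 1 ≤ ‖x‖ → F x = ‖x‖⁻¹ • x) : False := by
  have hU : {x : E | 1 < ‖x‖} ∈ nhdsSet {x : E | 2 ≤ ‖x‖} :=
    (isOpen_lt continuous_const continuous_norm).mem_nhdsSet.2 fun x hx =>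
      show 1 < ‖x‖ from one_lt_two.trans_le hx
  have hFU : ContDiffOn ℝ (1 : ℕ∞) F {x : E | 1 < ‖x‖} := by
    have hne : ∀ x ∈ {x : E | 1 < ‖x‖}, x ≠ 0 := fun x hx => norm_pos_iff.1 (one_pos.trans hx)
    exact (((contDiffOn_id.norm ℝ hne).inv fun x hx => norm_ne_zero_iff.2 (hne x hx)).smul
      contDiffOn_id).congr fun x hx => hfix x (le_of_lt hx)
  obtain ⟨g, hg, hdist, hgF, -⟩ := hF.exists_contDiff_approx_and_eqOn 1
    (ε := fun _ => 1 / 2) continuous_const (fun _ => by norm_num)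
    (isClosed_le continuous_const continuous_norm) hU hFU
  have hg0 : ∀ x, g x ≠ 0 := fun x h => by
    have := hdist x
    rw [h, dist_zero_left, hnorm] at this
    norm_num at this
  refine not_contDiff_retraction_sphere (r := fun x => (2 * ‖g x‖⁻¹) • g x) two_pos
    ((contDiff_const.mul ((hg.norm ℝ hg0).inv fun x => norm_ne_zero_iff.2 (hg0 x))).smul hg)
    (fun x => ?_) (fun x hx => ?_)
  · have := norm_ne_zero_iff.2 (hg0 x)
    rw [norm_smul, norm_mul, norm_inv, norm_norm]
    field_simp
    norm_num
  · have hgx : g x = (2 : ℝ)⁻¹ • x := by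
      rw [hgF (show 2 ≤ ‖x‖ from hx.ge), hfix x (by linarith), hx]
    simp [hgx, norm_smul, hx]

/-- In even dimension there is an injective linear map `J` with `J x` orthogonal to `x`; it restricts
to a nowhere-vanishing odd tangent vector field on the odd-dimensional sphere. -/
theorem exists_skew_injective {n : ℕ} (hn : Odd n) :
    ∃ J : EuclideanSpace ℝ (Fin (n + 1)) →L[ℝ] EuclideanSpace ℝ (Fin (n + 1)),
      (∀ x, inner ℝ x (J x) = 0) ∧ ∀ x, J x = 0 → x = 0 := by
  let ε : Fin (n + 1) → ℝ := fun i => if i < i.rev then 1 else -1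
  have hε : ∀ i, ε i.rev = -ε i := fun i => by
    obtain ⟨m, rfl⟩ := hn
    simp only [ε, Fin.lt_def, Fin.val_rev]
    split_ifs <;> first | omega | simp
  have hε0 : ∀ i, ε i ≠ 0 := fun i => by
    simp only [ε]
    split_ifs <;> norm_num
  let L : EuclideanSpace ℝ (Fin (n + 1)) →ₗ[ℝ] EuclideanSpace ℝ (Fin (n + 1)) :=
    { toFun := fun x => WithLp.toLp 2 fun i => ε i * x i.rev
      map_add' := fun x y => by ext i; simp [mul_add]
      map_smul' := fun c x => by ext i; simp [mul_left_comm] }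
  refine ⟨L.toContinuousLinearMap, fun x => ?_, fun x hx => ?_⟩
  · have h : inner ℝ x (L x) = ∑ i, ε i * x i.rev * x i := by simp [L, PiLp.inner_apply]
    have h' : ∑ i, ε i * x i.rev * x i = -∑ i, ε i * x i.rev * x i := by
      conv_lhs => rw [← Equiv.sum_comp Fin.revPerm]
      simp only [Fin.revPerm_apply, Fin.rev_rev, hε, ← Finset.sum_neg_distrib]
      exact Finset.sum_congr rfl fun i _ => by ring
    rw [LinearMap.coe_toContinuousLinearMap', h]
    linarith
  · ext i
    have := congrArg (fun y : EuclideanSpace ℝ (Fin (n + 1)) => y i.rev) hx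
    simpa [L, hε0] using this

/-- Normalizing `a t • x + b t • y + c t • J x` gives an equivariant motion planner on every set
where this combination does not vanish. -/
theorem exists_equivariant_section {n : ℕ}
    (U : Set (Metric.sphere (0 : EuclideanSpace ℝ (Fin (n + 1))) 1 ×
      Metric.sphere (0 : EuclideanSpace ℝ (Fin (n + 1))) 1))
    (J : EuclideanSpace ℝ (Fin (n + 1)) →L[ℝ] EuclideanSpace ℝ (Fin (n + 1)))
    {a b c : ℝ → ℝ} (ha : Continuous a) (hb : Continuous b) (hc : Continuous c)
    (h0 : a 0 = 1 ∧ b 0 = 0 ∧ c 0 = 0) (h1 : a 1 = 0 ∧ b 1 = 1 ∧ c 1 = 0)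
    (hne : ∀ u ∈ U, ∀ t ∈ I, a t • u.1.1 + b t • u.2.1 + c t • J u.1.1 ≠ 0) :
    ∃ s : C(U, C(I, Metric.sphere (0 : EuclideanSpace ℝ (Fin (n + 1))) 1)),
      (∀ u : U, pathEval _ (s u) = u.1) ∧
      ∀ (g : ℤˣ) (u : U) (hg : g • u.1 ∈ U) (t : I), (s ⟨g • u.1, hg⟩) t = g • (s u) t := by
  let p : U × I → EuclideanSpace ℝ (Fin (n + 1)) := fun q =>
    a q.2 • q.1.1.1.1 + b q.2 • q.1.1.2.1 + c q.2 • J q.1.1.1.1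
  have hp : Continuous p := by fun_prop
  have hp0 : ∀ q, p q ≠ 0 := fun q => hne _ q.1.2 _ q.2.2
  have hmem : ∀ q, ‖p q‖⁻¹ • p q ∈ Metric.sphere 0 1 := fun q => by simp [norm_smul, hp0 q]
  let f : C(U × I, Metric.sphere (0 : EuclideanSpace ℝ (Fin (n + 1))) 1) :=
    ⟨fun q => ⟨‖p q‖⁻¹ • p q, hmem q⟩, Continuous.subtype_mk
      ((hp.norm.inv₀ fun q => norm_ne_zero_iff.2 (hp0 q)).smul hp) hmem⟩
  refine ⟨f.curry, fun u => ?_, fun g u hg t => ?_⟩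
  · refine Prod.ext (Subtype.ext ?_) (Subtype.ext ?_) <;>
      simp [pathEval, f, p, h0, h1]
  · apply Subtype.ext
    change ‖p (⟨g • u.1, hg⟩, t)‖⁻¹ • p (⟨g • u.1, hg⟩, t) =
      ((g : ℤ) : ℝ) • (‖p (u, t)‖⁻¹ • p (u, t))
    have hpg : p (⟨g • u.1, hg⟩, t) = ((g : ℤ) : ℝ) • p (u, t) := by
      change a t • (((g : ℤ) : ℝ) • u.1.1.1) + b t • (((g : ℤ) : ℝ) • u.1.2.1) +
        c t • J (((g : ℤ) : ℝ) • u.1.1.1) = _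
      simp only [p, map_smul]
      module
    have hg1 : ‖((g : ℤ) : ℝ)‖ = 1 := by
      rcases Int.units_eq_one_or g with h | h <;> simp [h]
    rw [hpg, norm_smul, hg1, one_mul, smul_comm]

theorem eqTCCover_sphere_one {n : ℕ} (hn : Odd n) :
    EqTCCover ℤˣ (Metric.sphere (0 : EuclideanSpace ℝ (Fin (n + 1))) 1) 1 := by
  obtain ⟨J, hJ, hJ0⟩ := exists_skew_injective hn
  have hnorm : ∀ x : Metric.sphere (0 : EuclideanSpace ℝ (Fin (n + 1))) 1, ‖x.1‖ = 1 := by simp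
  have hx0 : ∀ x : Metric.sphere (0 : EuclideanSpace ℝ (Fin (n + 1))) 1, x.1 ≠ 0 := fun x h => by
    simpa [h] using hnorm x
  -- a vanishing combination of two unit vectors has coefficients of equal absolute value
  have habs : ∀ (x y : Metric.sphere (0 : EuclideanSpace ℝ (Fin (n + 1))) 1) (α β : ℝ),
      α • x.1 + β • y.1 = 0 → |α| = |β| := fun x y α β h => by
    simpa [norm_smul] using congrArg norm (eq_neg_of_add_eq_zero_left h)
  refine ⟨![{u | u.1.1 + u.2.1 ≠ 0}, {u | u.2.1 - u.1.1 ≠ 0}], ?_, ?_, ?_, ?_⟩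
  · exact Fin.forall_fin_two.2 ⟨isOpen_ne_fun (by fun_prop) (by fun_prop),
      isOpen_ne_fun (by fun_prop) (by fun_prop)⟩
  · refine eq_univ_of_forall fun u => mem_iUnion.2 ?_
    refine Fin.exists_fin_two.2 (show u.1.1 + u.2.1 ≠ 0 ∨ u.2.1 - u.1.1 ≠ 0 from ?_)
    by_contra! h
    refine hx0 u.1 ?_
    have : u.1.1 = (2 : ℝ)⁻¹ • ((u.1.1 + u.2.1) - (u.2.1 - u.1.1)) := by module
    rw [this, h.1, h.2, sub_zero, smul_zero]
  · have hg : ∀ g : ℤˣ, ((g : ℤ) : ℝ) ≠ 0 := fun g => by simp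
    refine Fin.forall_fin_two.2 ⟨fun g u hu => ?_, fun g u hu => ?_⟩
    · change ((g : ℤ) : ℝ) • u.1.1 + ((g : ℤ) : ℝ) • u.2.1 ≠ 0
      rw [← smul_add]
      exact smul_ne_zero (hg g) hu
    · change ((g : ℤ) : ℝ) • u.2.1 - ((g : ℤ) : ℝ) • u.1.1 ≠ 0
      rw [← smul_sub]
      exact smul_ne_zero (hg g) hu
  · rw [Fin.forall_fin_two]
    constructor
    · refine exists_equivariant_section _ J (a := fun t => 1 - t) (b := fun t => t)
        (c := fun _ => 0) (by fun_prop) (by fun_prop) (by fun_prop) (by simp) (by simp) ?_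
      rintro u hu t ht h
      simp only [zero_smul, add_zero] at h
      have hab := habs _ _ _ _ h
      rw [abs_of_nonneg (sub_nonneg.2 ht.2), abs_of_nonneg ht.1] at hab
      obtain rfl : t = 1 / 2 := by linarith
      refine hu ?_
      have : u.1.1 + u.2.1 = (2 : ℝ) • ((1 - 1 / 2 : ℝ) • u.1.1 + (1 / 2 : ℝ) • u.2.1) := by module
      rw [this, h, smul_zero]
    · refine exists_equivariant_section _ J (a := fun t => max (1 - 4 * t) (2 * t - 2))
        (b := fun t => max 0 (2 * t - 1)) (c := fun t => max 0 (t * (1 - 2 * t)))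
        (by fun_prop) (by fun_prop) (by fun_prop) (by norm_num) (by norm_num) ?_
      rintro u hu t ht h
      rcases le_or_gt t (1 / 2) with htl | htl
      · rw [max_eq_left (by linarith : 2 * t - 2 ≤ 1 - 4 * t), max_eq_left (by linarith),
          max_eq_right (mul_nonneg ht.1 (by linarith)), zero_smul, add_zero] at h
        have ha : 1 - 4 * t = 0 := by
          have := congrArg (fun y => inner ℝ u.1.1 y) h
          simpa [inner_add_right, inner_smul_right, hJ] using this
        obtain rfl : t = 1 / 4 := by linarith
        norm_num [hx0] at h
        exact hx0 _ (hJ0 _ h)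
      · rw [max_eq_right (by linarith : 1 - 4 * t ≤ 2 * t - 2), max_eq_right (by linarith),
          max_eq_left (mul_nonpos_of_nonneg_of_nonpos ht.1 (by linarith)), zero_smul,
          add_zero] at h
        have hab := habs _ _ _ _ h
        rw [abs_of_nonpos (by linarith [ht.2]), abs_of_nonneg (by linarith)] at hab
        obtain rfl : t = 3 / 4 := by linarith
        refine hu ?_
        have : u.2.1 - u.1.1 = (2 : ℝ) •
            ((2 * (3 / 4) - 2 : ℝ) • u.1.1 + (2 * (3 / 4) - 1 : ℝ) • u.2.1) := by module
        rw [this, h, smul_zero]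

theorem not_eqTCCover_sphere_zero (n : ℕ) :
    ¬ EqTCCover ℤˣ (Metric.sphere (0 : EuclideanSpace ℝ (Fin (n + 1))) 1) 0 := by
  rintro ⟨U, -, hcov, -, hs⟩
  obtain ⟨s, hs, -⟩ := hs 0
  have hU : ∀ u, u ∈ U 0 := fun u => by
    obtain ⟨i, hi⟩ := mem_iUnion.1 (hcov.symm ▸ mem_univ u)
    rwa [Fin.fin_one_eq_zero i] at hi
  obtain ⟨x₀, hx₀⟩ := NormedSpace.sphere_nonempty (E := EuclideanSpace ℝ (Fin (n + 1)))
    (x := 0) (r := 1) |>.2 zero_le_one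
  classical
  let ν : EuclideanSpace ℝ (Fin (n + 1)) → Metric.sphere (0 : EuclideanSpace ℝ (Fin (n + 1))) 1 :=
    fun x => if h : x = 0 then ⟨x₀, hx₀⟩ else ⟨‖x‖⁻¹ • x, by simp [norm_smul, h]⟩
  have hν0 : ∀ x, x ≠ 0 → (ν x : EuclideanSpace ℝ (Fin (n + 1))) = ‖x‖⁻¹ • x :=
    fun x hx => by simp [ν, hx]
  have hν : ∀ x, x ≠ 0 → ContinuousAt ν x := fun x hx => by
    refine Topology.IsInducing.subtypeVal.continuousAt_iff.2 ?_
    refine ((continuousAt_id.norm.inv₀ (norm_ne_zero_iff.2 hx)).smul continuousAt_id).congr ?_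
    filter_upwards [isOpen_ne.mem_nhds hx] with y hy
    exact (hν0 y hy).symm
  let F : EuclideanSpace ℝ (Fin (n + 1)) → EuclideanSpace ℝ (Fin (n + 1)) := fun x =>
    (s ⟨(⟨x₀, hx₀⟩, ν x), hU _⟩ (projIcc 0 1 zero_le_one (2 * ‖x‖ - 1))).1
  have hF0 : ∀ x, ‖x‖ ≤ 1 / 2 → F x = x₀ := fun x hx => by
    simp only [F]
    rw [projIcc_of_le_left _ (by linarith)]
    exact congrArg (fun q => (q.1 : EuclideanSpace ℝ (Fin (n + 1)))) (hs ⟨(⟨x₀, hx₀⟩, ν x), hU _⟩)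
  have hF1 : ∀ x, 1 ≤ ‖x‖ → F x = ‖x‖⁻¹ • x := fun x hx => by
    simp only [F]
    rw [projIcc_of_right_le _ (by linarith), ← hν0 x (norm_pos_iff.1 (by linarith))]
    exact congrArg (fun q => (q.2 : EuclideanSpace ℝ (Fin (n + 1)))) (hs ⟨(⟨x₀, hx₀⟩, ν x), hU _⟩)
  refine not_continuous_retraction_sphere (F := F) ?_ (fun x => by simp [F]) hF1
  refine continuous_iff_continuousAt.2 fun x => ?_
  rcases eq_or_ne x 0 with rfl | hx
  · refine (continuousAt_const (y := x₀)).congr ?_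
    filter_upwards [Metric.closedBall_mem_nhds (0 : EuclideanSpace ℝ (Fin (n + 1)))
      (one_half_pos (α := ℝ))] with x hx
    exact (hF0 x (by simpa using hx)).symm
  · have hpair : ContinuousAt (fun x => (⟨(⟨x₀, hx₀⟩, ν x), hU _⟩ : U 0)) x :=
      (continuousAt_codRestrict_iff (fun _ => hU _)).2 (continuousAt_const.prodMk (hν x hx))
    have hproj : Continuous fun x : EuclideanSpace ℝ (Fin (n + 1)) =>
        projIcc (0 : ℝ) 1 zero_le_one (2 * ‖x‖ - 1) :=
      continuous_projIcc.comp (by fun_prop)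
    have heval : Continuous fun q : U 0 × I => (s q.1 q.2).1 := by fun_prop
    exact heval.continuousAt.comp (hpair.prodMk hproj.continuousAt)

/-- Let `G = ℤ/2` act antipodally on the sphere `Sⁿ` with `n ≥ 1` odd. Then the
(reduced) equivariant topological complexity `TC_G(Sⁿ)` equals `1`. -/
theorem stmt4 (n : ℕ) (hn : 1 ≤ n) (hodd : Odd n) :
    eqTC ℤˣ (Metric.sphere (0 : EuclideanSpace ℝ (Fin (n + 1))) 1) = 1 := by
  refine le_antisymm (sInf_le ⟨1, eqTCCover_sphere_one hodd, by simp⟩) (le_sInf ?_)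
  rintro _ ⟨k, hk, rfl⟩
  have hk0 : k ≠ 0 := by
    rintro rfl
    exact not_eqTCCover_sphere_zero n hk
  exact_mod_cast Nat.one_le_iff_ne_zero.2 hk0

end
end

section
/- Let G = Z/2 act antipodally on the sphere Sⁿ with n ≥ 2 even. Then the equivariant topological complexity TC_G(Sⁿ) equals 2 (in reduced convention). -/
noncomputable section

open unitInterval Set

/-- The Jacobian matrix of a family of real functions on `ι → ℝ`. -/
def jacobian {ι : Type*} [Fintype ι] [DecidableEq ι] (u : ι → (ι → ℝ) → ℝ) (x : ι → ℝ) :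
    Matrix ι ι ℝ :=
  Matrix.of fun i j => fderiv ℝ (u i) x (Pi.single j 1)

theorem contDiff_fderiv_apply {ι : Type*} [Fintype ι] {u : (ι → ℝ) → ℝ} (hu : ContDiff ℝ 2 u)
    (v : ι → ℝ) :
    ContDiff ℝ 1 fun x => fderiv ℝ u x v :=
  (hu.fderiv_right (m := 1) (by norm_num)).clm_apply contDiff_const

section Jacobian

variable {ι : Type*} [Fintype ι] [DecidableEq ι]

theorem jacobian_det_eq (u : ι → (ι → ℝ) → ℝ) (x : ι → ℝ) (i₀ : ι) :
    (jacobian u x).det = ∑ τ : Equiv.Perm ι, ((Equiv.Perm.sign τ : ℤ) : ℝ) *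
      (fderiv ℝ (u i₀) x (Pi.single (τ i₀) 1) *
        ∏ i ∈ Finset.univ.erase i₀, fderiv ℝ (u i) x (Pi.single (τ i) 1)) := by
  rw [← Matrix.det_transpose, Matrix.det_apply']
  refine Finset.sum_congr rfl fun τ _ => ?_
  congr 1
  rw [Finset.mul_prod_erase Finset.univ (fun i => fderiv ℝ (u i) x (Pi.single (τ i) 1))
    (Finset.mem_univ i₀)]
  simp [jacobian]

theorem continuous_jacobian_det {u : ι → (ι → ℝ) → ℝ} (hu : ∀ i, ContDiff ℝ 2 (u i)) :
    Continuous fun x => (jacobian u x).det := by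
  refine Continuous.matrix_det (continuous_matrix fun i j => ?_)
  exact (contDiff_fderiv_apply (hu i) _).continuous

/-- The rows of the cofactor matrix of a Jacobian are divergence free. -/
theorem sum_sign_fderiv_prod_erase {u : ι → (ι → ℝ) → ℝ} (hu : ∀ i, ContDiff ℝ 2 (u i))
    (i₀ : ι) (x : ι → ℝ) :
    ∑ τ : Equiv.Perm ι, ((Equiv.Perm.sign τ : ℤ) : ℝ) *
      fderiv ℝ (fun y => ∏ i ∈ Finset.univ.erase i₀, fderiv ℝ (u i) y (Pi.single (τ i) 1)) x
        (Pi.single (τ i₀) 1) = 0 := by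
  have hd (i : ι) (v : ι → ℝ) : DifferentiableAt ℝ (fun y => fderiv ℝ (u i) y v) x :=
    (contDiff_fderiv_apply (hu i) v).differentiable (by norm_num) x
  have h2 (i : ι) (v w : ι → ℝ) :
      fderiv ℝ (fun y => fderiv ℝ (u i) y v) x w = fderiv ℝ (fderiv ℝ (u i)) x w v := by
    have : DifferentiableAt ℝ (fderiv ℝ (u i)) x :=
      ((hu i).fderiv_right (m := 1) (by norm_num)).differentiable (by norm_num) x
    rw [fderiv_clm_apply this (differentiableAt_const v)]
    simp
  have hsymm (i : ι) (v w : ι → ℝ) :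
      fderiv ℝ (fderiv ℝ (u i)) x w v = fderiv ℝ (fderiv ℝ (u i)) x v w :=
    (hu i).contDiffAt.isSymmSndFDerivAt (by simp) w v
  simp_rw [fderiv_finsetProd fun i _ => hd i _, sum_apply,
    smul_apply, h2, Finset.mul_sum]
  rw [Finset.sum_comm]
  refine Finset.sum_eq_zero fun k hk => ?_
  have hk₀ : k ≠ i₀ := Finset.ne_of_mem_erase hk
  have key (τ : Equiv.Perm ι) (j : ι) (hj : j ∈ (Finset.univ.erase i₀).erase k) :
      (τ * Equiv.swap i₀ k) j = τ j := by
    simp only [Finset.mem_erase] at hj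
    rw [Equiv.Perm.mul_apply, Equiv.swap_apply_of_ne_of_ne hj.2.1 hj.1]
  refine Finset.sum_involution (fun τ _ => τ * Equiv.swap i₀ k) (fun τ _ => ?_)
    (fun τ _ _ h => ?_) (fun τ _ => Finset.mem_univ _) (fun τ _ => ?_)
  · have hprod := Finset.prod_congr rfl fun j hj =>
      congrArg (fun a => fderiv ℝ (u j) x (Pi.single a 1)) (key τ j hj)
    rw [hprod, Equiv.Perm.sign_mul, Equiv.Perm.sign_swap hk₀.symm, Equiv.Perm.mul_apply,
      Equiv.Perm.mul_apply, Equiv.swap_apply_left, Equiv.swap_apply_right,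
      hsymm k (Pi.single (τ i₀) 1)]
    push_cast
    ring
  · have := congrArg (fun ρ : Equiv.Perm ι => ρ i₀) h
    simp only [Equiv.Perm.mul_apply, Equiv.swap_apply_left] at this
    exact hk₀ (τ.injective this)
  · simp [mul_assoc]

open MeasureTheory

theorem hasCompactSupport_jacobian_det {u : ι → (ι → ℝ) → ℝ} (i₀ : ι)
    (hc : HasCompactSupport (u i₀)) : HasCompactSupport fun x => (jacobian u x).det := by
  refine hc.mono' fun x hx => ?_
  by_contra h
  refine hx (Matrix.det_eq_zero_of_row_eq_zero i₀ fun j => ?_)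
  simp [jacobian, fderiv_of_notMem_tsupport ℝ h]

theorem integral_jacobian_det_eq_zero {u : ι → (ι → ℝ) → ℝ} (hu : ∀ i, ContDiff ℝ 2 (u i))
    (i₀ : ι) (hc : HasCompactSupport (u i₀)) : ∫ x, (jacobian u x).det = 0 := by
  set P : Equiv.Perm ι → (ι → ℝ) → ℝ := fun τ y =>
    ∏ i ∈ Finset.univ.erase i₀, fderiv ℝ (u i) y (Pi.single (τ i) 1) with hP
  have hPd (τ : Equiv.Perm ι) : ContDiff ℝ 1 (P τ) :=
    contDiff_prod fun i _ => contDiff_fderiv_apply (hu i) _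
  have hP' (τ : Equiv.Perm ι) (v : ι → ℝ) : Continuous fun x => fderiv ℝ (P τ) x v :=
    ((hPd τ).continuous_fderiv (by norm_num)).clm_apply continuous_const
  have hu' (v : ι → ℝ) : Continuous fun x => fderiv ℝ (u i₀) x v :=
    (contDiff_fderiv_apply (hu i₀) v).continuous
  have hc' (v : ι → ℝ) : HasCompactSupport fun x => fderiv ℝ (u i₀) x v :=
    hc.fderiv_apply (𝕜 := ℝ) v
  have hi1 (τ : Equiv.Perm ι) (v : ι → ℝ) :
      Integrable fun x => fderiv ℝ (u i₀) x v * P τ x :=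
    ((hu' v).mul (hPd τ).continuous).integrable_of_hasCompactSupport (hc' v).mul_right
  have hi2 (τ : Equiv.Perm ι) (v : ι → ℝ) :
      Integrable fun x => u i₀ x * fderiv ℝ (P τ) x v :=
    ((hu i₀).continuous.mul (hP' τ v)).integrable_of_hasCompactSupport hc.mul_right
  have hi3 (τ : Equiv.Perm ι) : Integrable fun x => u i₀ x * P τ x :=
    ((hu i₀).continuous.mul (hPd τ).continuous).integrable_of_hasCompactSupport hc.mul_right
  have parts (τ : Equiv.Perm ι) (v : ι → ℝ) :
      ∫ x, fderiv ℝ (u i₀) x v * P τ x = - ∫ x, u i₀ x * fderiv ℝ (P τ) x v := by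
    rw [integral_mul_fderiv_eq_neg_fderiv_mul_of_integrable (hi1 τ v) (hi2 τ v) (hi3 τ)
      (fun x _ => (hu i₀).differentiable (by norm_num) x)
      (fun x _ => (hPd τ).differentiable (by norm_num) x), neg_neg]
  simp_rw [jacobian_det_eq u _ i₀]
  rw [integral_finsetSum _ fun τ _ => (hi1 τ _).const_mul _]
  simp_rw [integral_const_mul]
  calc _ = ∑ τ : Equiv.Perm ι, -∫ x, ((Equiv.Perm.sign τ : ℤ) : ℝ) *
        (u i₀ x * fderiv ℝ (P τ) x (Pi.single (τ i₀) 1)) := by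
        refine Finset.sum_congr rfl fun τ _ => ?_
        rw [integral_const_mul, ← mul_neg, ← parts]
    _ = 0 := by
        rw [Finset.sum_neg_distrib, ← integral_finsetSum _ fun τ _ => (hi2 τ _).const_mul _]
        have (x : ι → ℝ) : ∑ τ : Equiv.Perm ι, ((Equiv.Perm.sign τ : ℤ) : ℝ) *
            (u i₀ x * fderiv ℝ (P τ) x (Pi.single (τ i₀) 1)) = 0 := by
          simp_rw [mul_left_comm _ (u i₀ x), ← Finset.mul_sum]
          rw [sum_sign_fderiv_prod_erase hu i₀ x, mul_zero]
        simp [this]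

/-- The integral of a Jacobian determinant only depends on the map outside a compact set. -/
theorem integral_jacobian_det_sub_eq_zero {f h : ι → (ι → ℝ) → ℝ}
    (hf : ∀ i, ContDiff ℝ 2 (f i)) (hh : ∀ i, ContDiff ℝ 2 (h i))
    (hc : ∀ i, HasCompactSupport (f i - h i)) :
    ∫ x, ((jacobian f x).det - (jacobian h x).det) = 0 := by
  suffices H : ∀ s : Finset ι,
      Integrable (fun x => (jacobian (s.piecewise f h) x).det - (jacobian h x).det) ∧
      ∫ x, ((jacobian (s.piecewise f h) x).det - (jacobian h x).det) = 0 by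
    simpa using (H Finset.univ).2
  intro s
  induction s using Finset.induction_on with
  | empty => simp
  | insert a s ha ih =>
    set m := s.piecewise f h with hm
    have hmd (i : ι) : ContDiff ℝ 2 (m i) := by
      by_cases hi : i ∈ s <;> simp [hm, hi, hf, hh]
    set w := Function.update m a (f a - h a) with hw
    have hwd (i : ι) : ContDiff ℝ 2 (w i) := by
      by_cases hi : i = a
      · subst hi; rw [hw, Function.update_self]; exact (hf i).sub (hh i)
      · simp [hw, hi, hmd]
    have hwc : HasCompactSupport (w a) := by simpa [hw] using hc a
    have step (x : ι → ℝ) : (jacobian ((insert a s).piecewise f h) x).det =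
        (jacobian m x).det + (jacobian w x).det := by
      have hrow (g : (ι → ℝ) → ℝ) : jacobian (Function.update m a g) x =
          (jacobian m x).updateRow a (fun j => fderiv ℝ g x (Pi.single j 1)) := by
        ext i j
        by_cases hi : i = a
        · subst hi; simp [jacobian]
        · simp [jacobian, hi]
      have hma : m = Function.update m a (h a) := by
        rw [eq_comm, Function.update_eq_self_iff]; simp [hm, ha]
      rw [Finset.piecewise_insert, ← hm]
      conv_rhs => rw [hma]
      rw [hw, hrow, hrow, hrow, ← Matrix.det_updateRow_add]
      congr 2
      ext j
      have := fderiv_sub ((hf a).differentiable (by norm_num) x)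
        ((hh a).differentiable (by norm_num) x)
      simp [this]
    have hwi : Integrable fun x => (jacobian w x).det :=
      (continuous_jacobian_det hwd).integrable_of_hasCompactSupport
        (hasCompactSupport_jacobian_det a hwc)
    have e : (fun x => (jacobian ((insert a s).piecewise f h) x).det - (jacobian h x).det) =
        fun x => ((jacobian m x).det - (jacobian h x).det) + (jacobian w x).det := by
      ext x; rw [step]; ring
    rw [e]
    refine ⟨ih.1.add hwi, ?_⟩
    rw [integral_add ih.1 hwi, ih.2, integral_jacobian_det_eq_zero hwd a hwc, add_zero]

end Jacobian

section Degree

variable {ι : Type*} [Fintype ι] [DecidableEq ι]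

/-- Post-composition with a smooth map that differs from the identity in one coordinate only
multiplies the Jacobian determinant by the partial derivative in that coordinate. -/
theorem jacobian_det_update_comp {f : (ι → ℝ) → ι → ℝ} {Ψ : (ι → ℝ) → ℝ} {x : ι → ℝ} (i₀ : ι)
    (hf : DifferentiableAt ℝ f x) (hΨ : DifferentiableAt ℝ Ψ (f x)) :
    (jacobian (fun i y => Function.update (f y) i₀ (Ψ (f y)) i) x).det =
      fderiv ℝ Ψ (f x) (Pi.single i₀ 1) * (jacobian (fun i y => f y i) x).det := by
  rw [← smul_eq_mul, ← Matrix.det_updateRow_sum (jacobian (fun i y => f y i) x) i₀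
    fun k => fderiv ℝ Ψ (f x) (Pi.single k 1)]
  congr 1
  ext i j
  have hk (k : ι) (v : ι → ℝ) : fderiv ℝ (fun y => f y k) x v = fderiv ℝ f x v k := by
    rw [(hasFDerivAt_pi'.1 hf.hasFDerivAt k).fderiv]
    rfl
  by_cases hi : i = i₀
  · subst hi
    have h1 : fderiv ℝ (fun y => Ψ (f y)) x = (fderiv ℝ Ψ (f x)).comp (fderiv ℝ f x) :=
      fderiv_comp x hΨ hf
    simp only [jacobian, Matrix.of_apply, Function.update_self, Matrix.updateRow_self, h1,
      ContinuousLinearMap.comp_apply, Finset.sum_apply, Pi.smul_apply, smul_eq_mul, hk]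
    conv_lhs => rw [pi_eq_sum_univ' (fderiv ℝ f x (Pi.single j 1)), map_sum]
    refine Finset.sum_congr rfl fun k _ => ?_
    rw [map_smul, smul_eq_mul, mul_comm]
  · simp [jacobian, hi]

/-- For every `r > 0` there is a function on `ι → ℝ` whose partial derivative in the coordinate
`i₀` is a nonnegative bump function supported in the ball of radius `r`. -/
theorem exists_bump_primitive (i₀ : ι) {r : ℝ} (hr : 0 < r) :
    ∃ Ψ : (ι → ℝ) → ℝ, ContDiff ℝ 2 Ψ ∧ (∀ y, 0 ≤ fderiv ℝ Ψ y (Pi.single i₀ 1)) ∧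
      0 < fderiv ℝ Ψ 0 (Pi.single i₀ 1) ∧
      ∀ y, fderiv ℝ Ψ y (Pi.single i₀ 1) ≠ 0 → ‖y‖ < r := by
  let b : ContDiffBump (0 : ℝ) := ⟨r / 2, r, by positivity, by linarith⟩
  have hb : ContDiff ℝ 2 b := b.contDiff
  let B : ℝ → ℝ := fun t => ∫ s in (0 : ℝ)..t, b s
  have hB (t : ℝ) : HasDerivAt B (b t) t :=
    intervalIntegral.integral_hasDerivAt_right (b.continuous.intervalIntegrable _ _)
      (b.continuous.stronglyMeasurableAtFilter _ _) b.continuous.continuousAt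
  have hB2 : ContDiff ℝ 2 B := by
    have hd : deriv B = b := funext fun t => (hB t).deriv
    rw [show (2 : WithTop ℕ∞) = 1 + 1 by norm_num, contDiff_succ_iff_deriv]
    refine ⟨fun t => (hB t).differentiableAt, by simp, ?_⟩
    rw [hd]; exact hb.of_le (by norm_num)
  let Q : (ι → ℝ) → ℝ := fun y => ∏ i ∈ Finset.univ.erase i₀, b (y i)
  have hbi (i : ι) : ContDiff ℝ 2 fun y : ι → ℝ => b (y i) := hb.comp (contDiff_apply ℝ ℝ i)
  have hQ : ContDiff ℝ 2 Q := contDiff_prod fun i _ => hbi i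
  have hQ0 (y : ι → ℝ) : fderiv ℝ Q y (Pi.single i₀ 1) = 0 := by
    simp only [Q]
    rw [fderiv_finsetProd fun i _ => (hbi i).differentiable (by norm_num) y, sum_apply]
    refine Finset.sum_eq_zero fun i hi => ?_
    have hd : HasFDerivAt (fun y : ι → ℝ => b (y i))
        (deriv b (y i) • ContinuousLinearMap.proj (R := ℝ) (φ := fun _ : ι => ℝ) i) y :=
      HasDerivAt.comp_hasFDerivAt (h₂ := b) (f := fun y : ι → ℝ => y i) y
        (hb.differentiable (by norm_num) (y i)).hasDerivAt (hasFDerivAt_apply i y)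
    rw [hd.fderiv]
    simp [Pi.single_eq_of_ne (Finset.ne_of_mem_erase hi)]
  have hBi : ContDiff ℝ 2 fun y : ι → ℝ => B (y i₀) := hB2.comp (contDiff_apply ℝ ℝ i₀)
  have key (y : ι → ℝ) : fderiv ℝ (fun y => B (y i₀) * Q y) y (Pi.single i₀ 1) =
      ∏ i, b (y i) := by
    have hd : HasFDerivAt (fun y : ι → ℝ => B (y i₀))
        (b (y i₀) • ContinuousLinearMap.proj (R := ℝ) (φ := fun _ : ι => ℝ) i₀) y :=
      HasDerivAt.comp_hasFDerivAt (h₂ := B) (f := fun y : ι → ℝ => y i₀) y (hB (y i₀))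
        (hasFDerivAt_apply i₀ y)
    rw [fderiv_fun_mul hd.differentiableAt (hQ.differentiable (by norm_num) y), hd.fderiv]
    rw [← Finset.mul_prod_erase Finset.univ (fun i => b (y i)) (Finset.mem_univ i₀)]
    simp [hQ0, Q, mul_comm]
  refine ⟨fun y => B (y i₀) * Q y, hBi.mul hQ, fun y => ?_, ?_, fun y hy => ?_⟩
  · rw [key]; exact Finset.prod_nonneg fun i _ => b.nonneg
  · rw [key]; exact Finset.prod_pos fun i _ => b.pos_of_mem_ball (by simp [b, hr])
  · rw [key] at hy
    refine (pi_norm_lt_iff hr).2 fun i => ?_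
    have : y i ∈ Function.support b := Finset.prod_ne_zero_iff.1 hy i (Finset.mem_univ i)
    rw [b.support_eq] at this
    simpa using this

/-- If `f` has a zero and only nondegenerate zeros of the same sign on a compact set, it cannot be
deformed inside that set to a map without zeros. -/
theorem false_of_no_zero_on_tsupport [Nonempty ι] {f h : (ι → ℝ) → ι → ℝ} (hf : ContDiff ℝ 2 f)
    (hh : ContDiff ℝ 2 h) (hc : HasCompactSupport (f - h)) (d : ℝ)
    (h0 : ∀ x ∈ tsupport (f - h), h x ≠ 0)
    (hd : ∀ x ∈ tsupport (f - h), f x = 0 → 0 < d * (jacobian (fun i y => f y i) x).det)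
    {x₀ : ι → ℝ} (hx₀ : x₀ ∈ tsupport (f - h)) (hfx₀ : f x₀ = 0) : False := by
  obtain ⟨i₀⟩ := ‹Nonempty ι›
  set K := tsupport (f - h) with hK
  have hKc : IsCompact K := hc
  have hfi (i : ι) : ContDiff ℝ 2 fun y => f y i := contDiff_pi.1 hf i
  have hJ : Continuous fun x => (jacobian (fun i y => f y i) x).det :=
    continuous_jacobian_det hfi
  obtain ⟨r₁, hr₁, hr₁'⟩ := hKc.exists_forall_le' (f := fun x => ‖h x‖) (a := 0)
    hh.continuous.norm.continuousOn fun x hx => norm_pos_iff.2 (h0 x hx)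
  have hK' : IsCompact (K ∩ {x | d * (jacobian (fun i y => f y i) x).det ≤ 0}) :=
    hKc.inter_right (isClosed_le (continuous_const.mul hJ) continuous_const)
  obtain ⟨r₂, hr₂, hr₂'⟩ := hK'.exists_forall_le' (f := fun x => ‖f x‖) (a := 0)
    hf.continuous.norm.continuousOn fun x hx =>
      norm_pos_iff.2 fun h => (hd x hx.1 h).not_ge hx.2
  obtain ⟨Ψ, hΨ, hΨ0, hΨpos, hΨr⟩ := exists_bump_primitive i₀ (lt_min hr₁ hr₂)
  let F : ((ι → ℝ) → ι → ℝ) → ι → (ι → ℝ) → ℝ :=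
    fun f i y => Function.update (f y) i₀ (Ψ (f y)) i
  have hF {f : (ι → ℝ) → ι → ℝ} (hf : ContDiff ℝ 2 f) (i : ι) : ContDiff ℝ 2 (F f i) := by
    by_cases hi : i = i₀
    · subst hi; simpa [F] using hΨ.fun_comp hf
    · simpa [F, hi] using contDiff_pi.1 hf i
  have hdet {f : (ι → ℝ) → ι → ℝ} (hf : ContDiff ℝ 2 f) (x : ι → ℝ) : (jacobian (F f) x).det =
      fderiv ℝ Ψ (f x) (Pi.single i₀ 1) * (jacobian (fun i y => f y i) x).det :=
    jacobian_det_update_comp i₀ (hf.differentiable (by norm_num) x)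
      (hΨ.differentiable (by norm_num) _)
  have hFc (i : ι) : HasCompactSupport (F f i - F h i) := by
    refine hc.mono fun x hx => ?_
    contrapose! hx
    have : f x = h x := by simpa [sub_eq_zero] using hx
    simp [F, this]
  have hzero := integral_jacobian_det_sub_eq_zero (hF hf) (hF hh) hFc
  set G : (ι → ℝ) → ℝ := fun x => d * ((jacobian (F f) x).det - (jacobian (F h) x).det) with hG
  have hGc : Continuous G := continuous_const.mul
    ((continuous_jacobian_det (hF hf)).sub (continuous_jacobian_det (hF hh)))
  have hGK (x : ι → ℝ) (hx : x ∉ K) : G x = 0 := by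
    have he : f =ᶠ[nhds x] h := by
      filter_upwards [(isClosed_tsupport (f - h)).isOpen_compl.mem_nhds hx] with y hy
      simpa [sub_eq_zero] using image_eq_zero_of_notMem_tsupport hy
    have : jacobian (F f) x = jacobian (F h) x := by
      ext i j
      simp only [jacobian, Matrix.of_apply]
      rw [Filter.EventuallyEq.fderiv_eq]
      filter_upwards [he] with y hy
      simp [F, hy]
    simp [hG, this]
  have hGeq (x : ι → ℝ) (hx : x ∈ K) : G x = fderiv ℝ Ψ (f x) (Pi.single i₀ 1) *
      (d * (jacobian (fun i y => f y i) x).det) := by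
    have : fderiv ℝ Ψ (h x) (Pi.single i₀ 1) = 0 := by
      by_contra hne
      exact ((hΨr _ hne).trans_le (min_le_left _ _)).not_ge (hr₁' x hx)
    simp only [hG, hdet hf, hdet hh, this]
    ring
  have hG0 : 0 ≤ G := fun x => by
    by_cases hx : x ∈ K
    · change 0 ≤ G x
      rw [hGeq x hx]
      by_cases hne : fderiv ℝ Ψ (f x) (Pi.single i₀ 1) = 0
      · simp [hne]
      · refine mul_nonneg (hΨ0 _) (le_of_not_ge fun hle => ?_)
        exact ((hΨr _ hne).trans_le (min_le_right _ _)).not_ge (hr₂' x ⟨hx, hle⟩)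
    · exact (hGK x hx).ge
  have hGx₀ : G x₀ ≠ 0 := by
    rw [hGeq x₀ hx₀, hfx₀]
    exact (mul_pos hΨpos (hd x₀ hx₀ hfx₀)).ne'
  have hGcs : HasCompactSupport G := HasCompactSupport.intro hKc hGK
  have := hGc.integral_pos_of_hasCompactSupport_nonneg_nonzero
    (μ := MeasureTheory.volume) hGcs hG0 hGx₀
  rw [hG, MeasureTheory.integral_const_mul, hzero, mul_zero] at this
  exact lt_irrefl _ this

/-- **Homotopy invariance of the degree**, in the form: if `f` has a zero and only nondegenerate
zeros of the same sign on the compact set `B`, and the linear homotopy from `f` to `h` has no zeros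
on the frontier of `B`, then `h` has a zero on `B`. -/
theorem exists_zero_of_linear_homotopy [Nonempty ι] {f h : (ι → ℝ) → ι → ℝ}
    (hf : ContDiff ℝ 2 f) (hh : Continuous h) {B : Set (ι → ℝ)} (hB : IsCompact B)
    (hbd : ∀ x ∈ B, x ∉ interior B → ∀ c ∈ Icc (0 : ℝ) 1, f x + c • (h x - f x) ≠ 0)
    (d : ℝ) (hd : ∀ x ∈ B, f x = 0 → 0 < d * (jacobian (fun i y => f y i) x).det)
    {x₀ : ι → ℝ} (hx₀ : x₀ ∈ B) (hfx₀ : f x₀ = 0) : ∃ x ∈ B, h x = 0 := by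
  by_contra! hne
  set Z : Set (ι → ℝ) := Prod.fst '' ((B ×ˢ Icc (0 : ℝ) 1) ∩
    {p : (ι → ℝ) × ℝ | f p.1 + p.2 • (h p.1 - f p.1) = 0}) with hZ
  have hfc := hf.continuous
  have hZc : IsCompact Z := by
    refine ((hB.prod isCompact_Icc).inter_right (isClosed_eq ?_ continuous_const)).image
      continuous_fst
    fun_prop
  have hdisj : Disjoint (interior B)ᶜ Z := by
    rw [Set.disjoint_left]
    rintro x hx ⟨⟨x', c⟩, ⟨⟨hxB, hc⟩, h0⟩, rfl⟩
    exact hbd _ hxB hx c hc h0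
  obtain ⟨χ, hχ0, hχ1, hχI⟩ := exists_continuous_zero_one_of_isClosed
    isOpen_interior.isClosed_compl hZc.isClosed hdisj
  set k : (ι → ℝ) → ι → ℝ := fun x => χ x • (h x - f x) with hk
  have hkc : Continuous k := by fun_prop
  have hfk (x : ι → ℝ) (hx : x ∈ B) : f x + k x ≠ 0 := by
    intro h0
    have hxZ : x ∈ Z := ⟨(x, χ x), ⟨⟨hx, hχI x⟩, h0⟩, rfl⟩
    have : χ x = 1 := hχ1 hxZ
    refine hne x hx ?_
    simpa [hk, this] using h0
  obtain ⟨r, hr, hr'⟩ := hB.exists_forall_le' (f := fun x => ‖f x + k x‖) (a := 0)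
    (by fun_prop) fun x hx => norm_pos_iff.2 (hfk x hx)
  obtain ⟨g, hg, hgk, hgs⟩ := hkc.exists_contDiff_approx 2 (ε := fun _ => r)
    continuous_const fun _ => hr
  have hfg (x : ι → ℝ) (hx : x ∈ B) : f x + g x ≠ 0 := by
    intro h0
    have h1 := hgk x
    have h2 := hr' x hx
    rw [dist_eq_norm, show g x - k x = -(f x + k x) by
      rw [eq_neg_of_add_eq_zero_right h0]; abel, norm_neg] at h1
    exact h1.not_ge h2
  have hsub : f - (f + g) = -g := by abel
  have hts : tsupport (f - (f + g)) ⊆ B := by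
    rw [hsub]
    refine closure_minimal ?_ hB.isClosed
    rw [Function.support_neg]
    refine hgs.trans fun x hx => ?_
    by_contra hxB
    have : χ x = 0 := hχ0 fun hi => hxB (interior_subset hi)
    simp [hk, this] at hx
  refine false_of_no_zero_on_tsupport hf (hf.add hg)
    (hB.of_isClosed_subset (isClosed_tsupport _) hts) d (fun x hx => hfg x (hts hx))
    (fun x hx => hd x (hts hx)) (x₀ := x₀) ?_ hfx₀
  refine subset_tsupport _ ?_
  change x₀ ∈ Function.support (f - (f + g))
  rw [hsub, Function.support_neg, Function.mem_support]
  intro h0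
  exact hfg x₀ hx₀ (by rw [hfx₀, h0, add_zero])

end Degree

section Symmetry

variable {ι : Type*} [Fintype ι] [DecidableEq ι]

theorem jacobian_mulVec {f : (ι → ℝ) → ι → ℝ} {x : ι → ℝ} (hf : DifferentiableAt ℝ f x)
    (v : ι → ℝ) : (jacobian (fun i y => f y i) x).mulVec v = fderiv ℝ f x v := by
  ext i
  conv_rhs => rw [pi_eq_sum_univ' v, map_sum]
  simp only [Matrix.mulVec, dotProduct, jacobian, Matrix.of_apply, Finset.sum_apply, map_smul,
    Pi.smul_apply, smul_eq_mul, (hasFDerivAt_pi'.1 hf.hasFDerivAt i).fderiv]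
  exact Finset.sum_congr rfl fun j _ => mul_comm _ _

theorem jacobian_det_mul_of_equivariant {f : (ι → ℝ) → ι → ℝ} (hf : Differentiable ℝ f)
    {ρ : ι → ℝ} (hρ : ∀ i, ρ i ≠ 0) (hfρ : ∀ x, f (ρ * x) = ρ * f x) (x : ι → ℝ) :
    (jacobian (fun i y => f y i) (ρ * x)).det = (jacobian (fun i y => f y i) x).det := by
  set D := Matrix.diagonal ρ
  have hD : D.det ≠ 0 := by
    rw [Matrix.det_diagonal]; exact Finset.prod_ne_zero_iff.2 fun i _ => hρ i
  have hDv (v : ι → ℝ) : D.mulVec v = ρ * v := by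
    ext i; simp [D, Matrix.mulVec_diagonal]
  have hmul : HasFDerivAt (fun y : ι → ℝ => ρ * y) (ContinuousLinearMap.mul ℝ (ι → ℝ) ρ) x :=
    (ContinuousLinearMap.mul ℝ (ι → ℝ) ρ).hasFDerivAt
  have hmul' : HasFDerivAt (fun y : ι → ℝ => ρ * y) (ContinuousLinearMap.mul ℝ (ι → ℝ) ρ) (f x) :=
    (ContinuousLinearMap.mul ℝ (ι → ℝ) ρ).hasFDerivAt
  have h1 := (hf (ρ * x)).hasFDerivAt.comp x hmul
  have h2 := hmul'.comp x (hf x).hasFDerivAt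
  have h12 : (f ∘ fun y => ρ * y) = (fun y => ρ * y) ∘ f := funext hfρ
  rw [h12] at h1
  have h3 := h1.unique h2
  have hm : jacobian (fun i y => f y i) (ρ * x) * D = D * jacobian (fun i y => f y i) x := by
    refine Matrix.ext_of_mulVec_single fun j => ?_
    rw [← Matrix.mulVec_mulVec, ← Matrix.mulVec_mulVec, hDv, hDv, jacobian_mulVec (hf _),
      jacobian_mulVec (hf _)]
    exact DFunLike.congr_fun h3 (Pi.single j 1)
  have := congrArg Matrix.det hm
  rw [Matrix.det_mul, Matrix.det_mul, mul_comm] at this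
  exact mul_left_cancel₀ hD this

end Symmetry

section Model

/-- The straight path from `x` to `y`, bent in the direction of `A x`. -/
def bentLine {E : Type*} [AddCommGroup E] [Module ℝ E] (A : E →ₗ[ℝ] E) (x y : E) (s : ℝ) : E :=
  (1 - s) • x + s • y + (s * (1 - s)) • A x

section BentLine

variable {E : Type*} [AddCommGroup E] [Module ℝ E] (A : E →ₗ[ℝ] E) (x y : E)

theorem bentLine_zero : bentLine A x y 0 = x := by
  simp [bentLine]

theorem bentLine_one : bentLine A x y 1 = y := by
  simp [bentLine]

theorem bentLine_smul (c s : ℝ) : bentLine A (c • x) (c • y) s = c • bentLine A x y s := by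
  simp only [bentLine, map_smul]
  module

theorem bentLine_neg (s : ℝ) : bentLine A (-x) (-y) s = -bentLine A x y s := by
  simpa using bentLine_smul A x y (-1) s

end BentLine

variable {κ : Type*}

theorem bentLine_apply (A : (κ → ℝ) →ₗ[ℝ] κ → ℝ) (x y : κ → ℝ) (s : ℝ) (i : κ) :
    bentLine A x y s i = (1 - s) * x i + s * y i + s * (1 - s) * A x i :=
  rfl

variable [Fintype κ]

/-- The map of `ℝ^κ × ℝ^κ × ℝ × ℝ` with components `F x y s`, `G x y t`, `|x|² - 1`, `|y|² - 1`. -/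
def stackMap (F G : (κ → ℝ) → (κ → ℝ) → ℝ → κ → ℝ) (p : κ ⊕ κ ⊕ Bool → ℝ) : κ ⊕ κ ⊕ Bool → ℝ :=
  Sum.elim (F (fun i => p (.inl i)) (fun i => p (.inr (.inl i))) (p (.inr (.inr false))))
    (Sum.elim (G (fun i => p (.inl i)) (fun i => p (.inr (.inl i))) (p (.inr (.inr true))))
      fun b => cond b (∑ i, p (.inr (.inl i)) ^ 2 - 1) (∑ i, p (.inl i) ^ 2 - 1))

theorem contDiff_stackMap_bentLine (A A' : (κ → ℝ) →ₗ[ℝ] κ → ℝ) :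
    ContDiff ℝ 2 (stackMap (bentLine A) (bentLine A')) := by
  have hA (A : (κ → ℝ) →ₗ[ℝ] κ → ℝ) (i : κ) :
      ContDiff ℝ 2 fun p : κ ⊕ κ ⊕ Bool → ℝ => A (fun i => p (.inl i)) i :=
    contDiff_pi.1 ((LinearMap.toContinuousLinearMap A).contDiff.comp
      (contDiff_pi.2 fun i => contDiff_apply ℝ ℝ (Sum.inl i : κ ⊕ κ ⊕ Bool))) i
  have hc (j : κ ⊕ κ ⊕ Bool) : ContDiff ℝ 2 fun p : κ ⊕ κ ⊕ Bool → ℝ => p j :=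
    contDiff_apply ℝ ℝ j
  refine contDiff_pi.2 fun j => ?_
  rcases j with i | i | b
  · exact (((contDiff_const.sub (hc _)).mul (hc _)).add ((hc _).mul (hc _))).add
      (((hc _).mul (contDiff_const.sub (hc _))).mul (hA A i))
  · exact (((contDiff_const.sub (hc _)).mul (hc _)).add ((hc _).mul (hc _))).add
      (((hc _).mul (contDiff_const.sub (hc _))).mul (hA A' i))
  · cases b
    · exact (ContDiff.sum fun i _ => (hc _).pow 2).sub contDiff_const
    · exact (ContDiff.sum fun i _ => (hc _).pow 2).sub contDiff_const

/-- The sign change `(x, y, s, t) ↦ (-x, -y, s, t)`. -/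
def modelSign (κ : Type*) : κ ⊕ κ ⊕ Bool → ℝ :=
  Sum.elim (-1) (Sum.elim (-1) 1)

theorem stackMap_bentLine_modelSign_mul (A A' : (κ → ℝ) →ₗ[ℝ] κ → ℝ) (p : κ ⊕ κ ⊕ Bool → ℝ) :
    stackMap (bentLine A) (bentLine A') (modelSign κ * p) =
      modelSign κ * stackMap (bentLine A) (bentLine A') p := by
  have h1 : (fun i => (modelSign κ * p) (.inl i)) = -fun i => p (.inl i) := by
    ext i; simp [modelSign]
  have h2 : (fun i => (modelSign κ * p) (.inr (.inl i))) = -fun i => p (.inr (.inl i)) := by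
    ext i; simp [modelSign]
  have h3 (b : Bool) : (modelSign κ * p) (.inr (.inr b)) = p (.inr (.inr b)) := by
    simp [modelSign]
  ext j
  rcases j with i | i | b
  · simp only [stackMap, h1, h2, h3, bentLine_neg]
    simp [modelSign]
  · simp only [stackMap, h1, h2, h3, bentLine_neg]
    simp [modelSign]
  · cases b <;> simp [stackMap, modelSign]

theorem continuous_stackMap {F G : (κ → ℝ) → (κ → ℝ) → ℝ → κ → ℝ}
    (hF : Continuous fun q : (κ → ℝ) × (κ → ℝ) × ℝ => F q.1 q.2.1 q.2.2)
    (hG : Continuous fun q : (κ → ℝ) × (κ → ℝ) × ℝ => G q.1 q.2.1 q.2.2) :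
    Continuous (stackMap F G) := by
  have hx : Continuous fun (p : κ ⊕ κ ⊕ Bool → ℝ) (i : κ) => p (.inl i) := by fun_prop
  have hy : Continuous fun (p : κ ⊕ κ ⊕ Bool → ℝ) (i : κ) => p (.inr (.inl i)) := by fun_prop
  have hb (b : Bool) : Continuous fun p : κ ⊕ κ ⊕ Bool → ℝ => p (.inr (.inr b)) := by fun_prop
  refine continuous_pi fun j => ?_
  rcases j with i | i | b
  · exact (continuous_apply i).comp (hF.comp (hx.prodMk (hy.prodMk (hb false))))
  · exact (continuous_apply i).comp (hG.comp (hx.prodMk (hy.prodMk (hb true))))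
  · cases b <;> simp only [stackMap, Sum.elim_inr, cond_true, cond_false] <;> fun_prop

/-- On the frontier of the box, all the maps of the linear homotopy from the model map to
`stackMap F G` are nonzero. -/
theorem stackMap_homotopy_ne_zero {A A' : (κ → ℝ) →ₗ[ℝ] κ → ℝ}
    {F G : (κ → ℝ) → (κ → ℝ) → ℝ → κ → ℝ}
    (hF0 : ∀ x y, ∑ i, x i ^ 2 = 1 → ∑ i, y i ^ 2 = 1 → F x y 0 = x)
    (hF1 : ∀ x y, ∑ i, x i ^ 2 = 1 → ∑ i, y i ^ 2 = 1 → F x y 1 = y)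
    (hG0 : ∀ x y, ∑ i, x i ^ 2 = 1 → ∑ i, y i ^ 2 = 1 → G x y 0 = x)
    (hG1 : ∀ x y, ∑ i, x i ^ 2 = 1 → ∑ i, y i ^ 2 = 1 → G x y 1 = y)
    {p : κ ⊕ κ ⊕ Bool → ℝ} {j : κ ⊕ κ ⊕ Bool}
    (hj : p j = Sum.elim (fun _ => -2) (Sum.elim (fun _ => -2) fun _ => 0) j ∨
      p j = Sum.elim (fun _ => 2) (Sum.elim (fun _ => 2) fun _ => 1) j) (c : ℝ) :
    stackMap (bentLine A) (bentLine A') p +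
      c • (stackMap F G p - stackMap (bentLine A) (bentLine A') p) ≠ 0 := by
  intro h0
  set x : κ → ℝ := fun i => p (.inl i) with hx
  set y : κ → ℝ := fun i => p (.inr (.inl i)) with hy
  have hx1 : ∑ i, x i ^ 2 = 1 := by
    simpa [stackMap, sub_eq_zero] using congrFun h0 (.inr (.inr false))
  have hy1 : ∑ i, y i ^ 2 = 1 := by
    simpa [stackMap, sub_eq_zero] using congrFun h0 (.inr (.inr true))
  have hsmall {z : κ → ℝ} (hz : ∑ i, z i ^ 2 = 1) (i : κ) : z i ^ 2 ≤ 1 :=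
    hz ▸ Finset.single_le_sum (f := fun i => z i ^ 2) (fun i _ => sq_nonneg _) (Finset.mem_univ i)
  have hne {z : κ → ℝ} (hz : ∑ i, z i ^ 2 = 1) : z ≠ 0 := by
    rintro rfl
    simp at hz
  have hfirst (i : κ) : bentLine A x y (p (.inr (.inr false))) i +
      c * (F x y (p (.inr (.inr false))) i - bentLine A x y (p (.inr (.inr false))) i) = 0 :=
    congrFun h0 (.inl i)
  have hsecond (i : κ) : bentLine A' x y (p (.inr (.inr true))) i +
      c * (G x y (p (.inr (.inr true))) i - bentLine A' x y (p (.inr (.inr true))) i) = 0 :=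
    congrFun h0 (.inr (.inl i))
  rcases j with i | i | b
  · have := hsmall hx1 i
    rcases hj with hj | hj <;> simp only [hx, hj, Sum.elim_inl] at this <;> norm_num at this
  · have := hsmall hy1 i
    rcases hj with hj | hj <;> simp only [hy, hj, Sum.elim_inl, Sum.elim_inr] at this <;>
      norm_num at this
  · cases b
    · rcases hj with hj | hj <;> simp only [Sum.elim_inr] at hj <;> simp only [hj] at hfirst
      · exact hne hx1 (funext fun i => by simpa [bentLine_zero, hF0 x y hx1 hy1] using hfirst i)
      · exact hne hy1 (funext fun i => by simpa [bentLine_one, hF1 x y hx1 hy1] using hfirst i)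
    · rcases hj with hj | hj <;> simp only [Sum.elim_inr] at hj <;> simp only [hj] at hsecond
      · exact hne hx1 (funext fun i => by simpa [bentLine_zero, hG0 x y hx1 hy1] using hsecond i)
      · exact hne hy1 (funext fun i => by simpa [bentLine_one, hG1 x y hx1 hy1] using hsecond i)

variable [DecidableEq κ]

/-- The zero of the model map, unique up to the antipodal symmetry. -/
def modelZero (e : κ) : κ ⊕ κ ⊕ Bool → ℝ :=
  Sum.elim (Pi.single e 1) (Sum.elim (-Pi.single e 1) fun _ => 1 / 2)

theorem jacobian_det_modelZero_ne_zero {A : (κ → ℝ) →ₗ[ℝ] κ → ℝ} {e : κ}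
    (hskew : ∀ x, ∑ i, A x i * x i = 0) (he : A (Pi.single e 1) = 0)
    (hker : ∀ x, A x = 0 → ∀ i ≠ e, x i = 0) :
    (jacobian (fun i p => stackMap (bentLine 0) (bentLine A) p i) (modelZero e)).det ≠ 0 := by
  set f := stackMap (bentLine 0) (bentLine A)
  have hf : Differentiable ℝ f := (contDiff_stackMap_bentLine 0 A).differentiable (by norm_num)
  set p := modelZero e
  intro hdet
  obtain ⟨v, hv0, hv⟩ := Matrix.exists_mulVec_eq_zero_iff.2 hdet
  rw [jacobian_mulVec (hf p)] at hv
  have hline (j : κ ⊕ κ ⊕ Bool) : HasDerivAt (fun r : ℝ => f (p + r • v) j) 0 0 := by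
    have h1 : HasDerivAt (fun r : ℝ => p + r • v) v 0 := by
      simpa using ((hasDerivAt_id (0 : ℝ)).smul_const v).const_add p
    have h2 : HasFDerivAt f (fderiv ℝ f p) (p + (0 : ℝ) • v) := by
      simpa using (hf p).hasFDerivAt
    have h3 := h2.comp_hasDerivAt 0 h1
    rw [hv] at h3
    exact hasDerivAt_pi.1 h3 j
  have lin (a b : ℝ) : HasDerivAt (fun r : ℝ => a + r * b) b 0 := by
    simpa using ((hasDerivAt_id (0 : ℝ)).mul_const b).const_add a
  set u : κ → ℝ := Pi.single e 1 with hu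
  set ξ : κ → ℝ := fun i => v (.inl i) with hξ
  set η : κ → ℝ := fun i => v (.inr (.inl i)) with hη
  have bent (A : (κ → ℝ) →ₗ[ℝ] κ → ℝ) (hA : A u = 0) (σ₁ : ℝ) (i : κ) :
      HasDerivAt (fun r : ℝ => bentLine A (u + r • ξ) (-u + r • η) (1 / 2 + r * σ₁) i)
        ((ξ i + η i) / 2 - 2 * σ₁ * u i + A ξ i / 4) 0 := by
    have hh := (((lin (1 / 2) (-σ₁)).mul (lin (u i) (ξ i))).add
      ((lin (1 / 2) σ₁).mul (lin (-u i) (η i)))).add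
      (((lin (1 / 2) σ₁).mul (lin (1 / 2) (-σ₁))).mul (lin 0 (A ξ i)))
    convert! hh using 1
    · ext r
      simp only [bentLine_apply, map_add, map_smul, hA, Pi.add_apply, Pi.smul_apply, smul_eq_mul,
        Pi.neg_apply, Pi.mul_apply, Pi.zero_apply]
      ring
    · simp only [Pi.mul_apply]
      ring
  have hx (r : ℝ) : (fun i => (p + r • v) (.inl i)) = u + r • ξ := by
    ext i; simp [p, modelZero, hu, hξ]
  have hy (r : ℝ) : (fun i => (p + r • v) (.inr (.inl i))) = -u + r • η := by
    ext i; simp [p, modelZero, hu, hη]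
  have hb (r : ℝ) (b : Bool) : (p + r • v) (.inr (.inr b)) = 1 / 2 + r * v (.inr (.inr b)) := by
    simp [p, modelZero]
  have e1 (i : κ) : (ξ i + η i) / 2 - 2 * v (.inr (.inr false)) * u i = 0 := by
    have h1 := hline (.inl i)
    simp only [f, stackMap, Sum.elim_inl, hx, hy, hb] at h1
    simpa using (bent 0 rfl _ i).unique h1
  have e2 (i : κ) : (ξ i + η i) / 2 - 2 * v (.inr (.inr true)) * u i + A ξ i / 4 = 0 := by
    have h1 := hline (.inr (.inl i))
    simp only [f, stackMap, Sum.elim_inl, Sum.elim_inr, hx, hy, hb] at h1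
    exact (bent A he _ i).unique h1
  have sq (w z : κ → ℝ) : HasDerivAt (fun r : ℝ => ∑ i, (w + r • z) i ^ 2 - 1)
      (∑ i, 2 * w i * z i) 0 := by
    refine HasDerivAt.sub_const 1 (HasDerivAt.fun_sum fun i _ => ?_)
    convert! (lin (w i) (z i)).pow 2 using 1
    · simp
  have e3 : ξ e = 0 := by
    have h1 := hline (.inr (.inr false))
    have hx' (r : ℝ) (i : κ) : (p + r • v) (.inl i) = (u + r • ξ) i := congrFun (hx r) i
    simp only [f, stackMap, Sum.elim_inr, cond_false, hx'] at h1
    simpa [hu, Pi.single_apply] using (sq u ξ).unique h1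
  have e4 : η e = 0 := by
    have h1 := hline (.inr (.inr true))
    have hy' (r : ℝ) (i : κ) : (p + r • v) (.inr (.inl i)) = (-u + r • η) i := congrFun (hy r) i
    simp only [f, stackMap, Sum.elim_inr, cond_true, hy'] at h1
    simpa [hu, Pi.single_apply] using (sq (-u) η).unique h1
  have hue : u e = 1 := by simp [hu]
  have e5 : v (.inr (.inr false)) = 0 := by
    have := e1 e
    rw [e3, e4, hue] at this
    linarith
  have e6 (i : κ) : ξ i + η i = 0 := by
    have := e1 i
    rw [e5] at this
    linarith
  have e7 (i : κ) : A ξ i = 8 * v (.inr (.inr true)) * u i := by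
    have := e2 i
    rw [e6] at this
    linarith
  -- polarize skewness to see that the image of `A` is orthogonal to its kernel
  have e8 : A ξ e = 0 := by
    have h := hskew (ξ + u)
    simp only [map_add, he, Pi.add_apply, mul_add, Finset.sum_add_distrib] at h
    simpa [hu, Pi.single_apply, hskew ξ] using h
  have e9 : v (.inr (.inr true)) = 0 := by
    have := e7 e
    rw [e8, hue] at this
    linarith
  have e10 (i : κ) : ξ i = 0 := by
    by_cases hi : i = e
    · rw [hi, e3]
    · refine hker ξ (funext fun i => ?_) i hi
      rw [e7, e9]; simp
  refine hv0 (funext fun j => ?_)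
  rcases j with i | i | b
  · exact e10 i
  · have := e6 i
    rw [e10] at this
    simpa using this
  · cases b
    · exact e5
    · exact e9

theorem eq_modelZero_or_of_stackMap_eq_zero {A : (κ → ℝ) →ₗ[ℝ] κ → ℝ} {e : κ}
    (hskew : ∀ x, ∑ i, A x i * x i = 0)
    (hker : ∀ x, A x = 0 → ∀ i ≠ e, x i = 0) {p : κ ⊕ κ ⊕ Bool → ℝ}
    (hp : stackMap (bentLine 0) (bentLine A) p = 0) :
    p = modelZero e ∨ p = modelSign κ * modelZero e := by
  set x : κ → ℝ := fun i => p (.inl i) with hx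
  set y : κ → ℝ := fun i => p (.inr (.inl i)) with hy
  set s := p (.inr (.inr false)) with hs
  set t := p (.inr (.inr true)) with ht
  have h1 (i : κ) : (1 - s) * x i + s * y i = 0 := by
    simpa [stackMap, bentLine_apply] using congrFun hp (.inl i)
  have h2 (i : κ) : (1 - t) * x i + t * y i + t * (1 - t) * A x i = 0 :=
    congrFun hp (.inr (.inl i))
  have h3 : ∑ i, x i ^ 2 = 1 := by
    have := congrFun hp (.inr (.inr false))
    simpa [stackMap, sub_eq_zero] using this
  have h4 : ∑ i, y i ^ 2 = 1 := by
    have := congrFun hp (.inr (.inr true))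
    simpa [stackMap, sub_eq_zero] using this
  have hs2 : s = 1 / 2 := by
    have h : (1 - s) ^ 2 * ∑ i, x i ^ 2 = s ^ 2 * ∑ i, y i ^ 2 := by
      rw [Finset.mul_sum, Finset.mul_sum]
      refine Finset.sum_congr rfl fun i _ => ?_
      linear_combination ((1 - s) * x i - s * y i) * h1 i
    rw [h3, h4] at h
    linarith
  have hyx (i : κ) : y i = -x i := by
    have := h1 i
    rw [hs2] at this
    linarith
  have ht2 : t = 1 / 2 := by
    have h : (1 - 2 * t) * ∑ i, x i ^ 2 + t * (1 - t) * ∑ i, A x i * x i = 0 := by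
      rw [Finset.mul_sum, Finset.mul_sum, ← Finset.sum_add_distrib]
      refine Finset.sum_eq_zero fun i _ => ?_
      have := h2 i
      rw [hyx] at this
      linear_combination x i * this
    rw [h3, hskew] at h
    linarith
  have hAx : A x = 0 := by
    ext i
    have := h2 i
    rw [hyx, ht2] at this
    simp only [Pi.zero_apply]
    linarith
  have hxi := hker x hAx
  have hxe : x e ^ 2 = 1 := by
    rw [← h3, Finset.sum_eq_single e (fun i _ hi => by rw [hxi i hi]; norm_num) (by simp)]
  have hxs : x = x e • Pi.single e 1 := by
    ext i
    by_cases hi : i = e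
    · subst hi; simp
    · simp [hxi i hi, hi]
  have hpe : p = Sum.elim x (Sum.elim (-x) fun _ => 1 / 2) := by
    ext j
    rcases j with i | i | b
    · rfl
    · exact hyx i
    · cases b
      · exact hs2
      · exact ht2
  rcases mul_self_eq_one_iff.1 ((sq (x e)).symm.trans hxe) with h | h
  · left
    rw [h, one_smul] at hxs
    rw [hpe, hxs, modelZero]
  · right
    rw [h] at hxs
    rw [hpe, hxs, modelZero, modelSign]
    ext j
    rcases j with i | i | b <;> simp

theorem stackMap_bentLine_modelZero {A : (κ → ℝ) →ₗ[ℝ] κ → ℝ} {e : κ}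
    (he : A (Pi.single e 1) = 0) : stackMap (bentLine 0) (bentLine A) (modelZero e) = 0 := by
  have h1 : (fun i => modelZero e (.inl i)) = Pi.single e (1 : ℝ) := rfl
  ext j
  rcases j with i | i | b
  · simp [stackMap, bentLine_apply, modelZero]
    ring
  · simp only [stackMap, Sum.elim_inr, Sum.elim_inl, bentLine_apply, h1, he]
    simp [modelZero]
    ring
  · cases b <;> simp [stackMap, modelZero, Pi.single_apply]

/-- Two families of paths in `ℝ^κ` joining all pairs of unit vectors vanish simultaneously. -/
theorem exists_common_zero {A : (κ → ℝ) →ₗ[ℝ] κ → ℝ} {e : κ}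
    (hskew : ∀ x, ∑ i, A x i * x i = 0) (he : A (Pi.single e 1) = 0)
    (hker : ∀ x, A x = 0 → ∀ i ≠ e, x i = 0)
    {F G : (κ → ℝ) → (κ → ℝ) → ℝ → κ → ℝ}
    (hF : Continuous fun q : (κ → ℝ) × (κ → ℝ) × ℝ => F q.1 q.2.1 q.2.2)
    (hG : Continuous fun q : (κ → ℝ) × (κ → ℝ) × ℝ => G q.1 q.2.1 q.2.2)
    (hF0 : ∀ x y, ∑ i, x i ^ 2 = 1 → ∑ i, y i ^ 2 = 1 → F x y 0 = x)
    (hF1 : ∀ x y, ∑ i, x i ^ 2 = 1 → ∑ i, y i ^ 2 = 1 → F x y 1 = y)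
    (hG0 : ∀ x y, ∑ i, x i ^ 2 = 1 → ∑ i, y i ^ 2 = 1 → G x y 0 = x)
    (hG1 : ∀ x y, ∑ i, x i ^ 2 = 1 → ∑ i, y i ^ 2 = 1 → G x y 1 = y) :
    ∃ (x y : κ → ℝ) (s t : ℝ), ∑ i, x i ^ 2 = 1 ∧ ∑ i, y i ^ 2 = 1 ∧ s ∈ I ∧ t ∈ I ∧
      F x y s = 0 ∧ G x y t = 0 := by
  set lo : κ ⊕ κ ⊕ Bool → ℝ := Sum.elim (fun _ => -2) (Sum.elim (fun _ => -2) fun _ => 0) with hlo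
  set hi : κ ⊕ κ ⊕ Bool → ℝ := Sum.elim (fun _ => 2) (Sum.elim (fun _ => 2) fun _ => 1) with hhi
  set f := stackMap (bentLine 0) (bentLine A) with hf
  set B : Set (κ ⊕ κ ⊕ Bool → ℝ) := Set.pi univ fun j => Icc (lo j) (hi j) with hB
  have hfd : Differentiable ℝ f := (contDiff_stackMap_bentLine 0 A).differentiable (by norm_num)
  have hdet := jacobian_det_modelZero_ne_zero hskew he hker
  obtain ⟨p, hpB, hp⟩ := exists_zero_of_linear_homotopy (contDiff_stackMap_bentLine 0 A)
    (continuous_stackMap hF hG) (B := B) (isCompact_univ_pi fun j => isCompact_Icc)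
    (fun p hp hpi c _ => by
      rw [hB, interior_pi_set Set.finite_univ] at hpi
      simp only [interior_Icc, Set.mem_pi, Set.mem_univ, forall_const, not_forall] at hpi
      obtain ⟨j, hj⟩ := hpi
      refine stackMap_homotopy_ne_zero hF0 hF1 hG0 hG1 (j := j) ?_ c
      obtain ⟨h1, h2⟩ := hp j trivial
      by_contra! hne
      exact hj ⟨h1.lt_of_ne hne.1.symm, h2.lt_of_ne hne.2⟩)
    (jacobian (fun i p => f p i) (modelZero e)).det
    (fun p _ hp => by
      have : (jacobian (fun i p => f p i) p).det =
          (jacobian (fun i p => f p i) (modelZero e)).det := by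
        rcases eq_modelZero_or_of_stackMap_eq_zero hskew hker hp with rfl | rfl
        · rfl
        · exact jacobian_det_mul_of_equivariant hfd
            (by rintro (i | i | b) <;> simp [modelSign]) (stackMap_bentLine_modelSign_mul 0 A) _
      change 0 < _ * (jacobian (fun i p => f p i) p).det
      rw [this]
      exact mul_self_pos.2 hdet)
    (x₀ := modelZero e)
    (by
      rintro (i | i | b) -
      · by_cases h : i = e <;> norm_num [hlo, hhi, modelZero, h]
      · by_cases h : i = e <;> norm_num [hlo, hhi, modelZero, h]
      · norm_num [hlo, hhi, modelZero])
    (stackMap_bentLine_modelZero he)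
  refine ⟨fun i => p (.inl i), fun i => p (.inr (.inl i)), p (.inr (.inr false)),
    p (.inr (.inr true)), ?_, ?_, hpB (.inr (.inr false)) trivial, hpB (.inr (.inr true)) trivial,
    funext fun i => congrFun hp (.inl i), funext fun i => congrFun hp (.inr (.inl i))⟩
  · simpa [stackMap, sub_eq_zero] using congrFun hp (.inr (.inr false))
  · simpa [stackMap, sub_eq_zero] using congrFun hp (.inr (.inr true))

end Model

section LowerBound

variable {κ : Type*} [Fintype κ]

theorem exists_extension_of_section {X : Set (EuclideanSpace ℝ κ)} (hX : IsCompact X)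
    (hX0 : 0 ∉ X) {U K : Set (X × X)} (hK : IsClosed K) (hKU : K ⊆ U) (s : C(U, C(I, X)))
    (hs : ∀ u : U, pathEval X (s u) = (u : X × X)) :
    ∃ F : (κ → ℝ) → (κ → ℝ) → ℝ → κ → ℝ,
      (Continuous fun q : (κ → ℝ) × (κ → ℝ) × ℝ => F q.1 q.2.1 q.2.2) ∧
      ∀ q : X × X, F q.1.1 q.2.1 0 = q.1.1 ∧ F q.1.1 q.2.1 1 = q.2.1 ∧
        (q ∈ K → ∀ t ∈ I, F q.1.1 q.2.1 t ≠ 0) := by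
  classical
  have : CompactSpace X := isCompact_iff_compactSpace.1 hX
  let φ : (X × X) × I → κ → ℝ := fun q => if h : q.1 ∈ U then
    ((s ⟨q.1, h⟩ q.2 : X) : EuclideanSpace ℝ κ) else
    (if q.2 = 0 then (q.1.1 : EuclideanSpace ℝ κ) else (q.1.2 : EuclideanSpace ℝ κ))
  have hφ0 (q : X × X) : φ (q, 0) = q.1 := by
    by_cases h : q ∈ U
    · simp only [φ, h, dite_true]
      rw [show s ⟨q, h⟩ 0 = q.1 from congrArg Prod.fst (hs ⟨q, h⟩)]
    · simp [φ, h]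
  have hφ1 (q : X × X) : φ (q, 1) = q.2 := by
    by_cases h : q ∈ U
    · simp only [φ, h, dite_true]
      rw [show s ⟨q, h⟩ 1 = q.2 from congrArg Prod.snd (hs ⟨q, h⟩)]
    · simp [φ, h]
  have hφU (q : U) (t : I) : φ (q, t) = (s q t : X) := by
    simp only [φ, q.2, dite_true]
  have hcoe : Continuous fun x : X => ((x : EuclideanSpace ℝ κ) : κ → ℝ) :=
    (PiLp.continuous_ofLp 2 _).comp continuous_subtype_val
  have hcK : ContinuousOn φ (Prod.fst ⁻¹' K) := by
    rw [continuousOn_iff_continuous_domRestrict]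
    have : Continuous fun q : (Prod.fst ⁻¹' K : Set ((X × X) × I)) =>
        (((s ⟨q.1.1, hKU q.2⟩ q.1.2 : X) : EuclideanSpace ℝ κ) : κ → ℝ) := by
      refine hcoe.comp ?_
      refine ContinuousEval.continuous_eval.comp (Continuous.prodMk (s.continuous.comp ?_) ?_)
      · exact Continuous.subtype_mk (by fun_prop) _
      · fun_prop
    refine this.congr fun q => ?_
    exact (hφU ⟨q.1.1, hKU q.2⟩ q.1.2).symm
  have hc0 : ContinuousOn φ (Prod.snd ⁻¹' {0}) := by
    refine (hcoe.comp (continuous_fst.comp continuous_fst)).continuousOn.congr ?_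
    rintro ⟨q, t⟩ (rfl : t = 0)
    exact hφ0 q
  have hc1 : ContinuousOn φ (Prod.snd ⁻¹' {1}) := by
    refine (hcoe.comp (continuous_snd.comp continuous_fst)).continuousOn.congr ?_
    rintro ⟨q, t⟩ (rfl : t = 1)
    exact hφ1 q
  have hK' : IsClosed (Prod.fst ⁻¹' K : Set ((X × X) × I)) := hK.preimage continuous_fst
  have h0 : IsClosed (Prod.snd ⁻¹' {0} : Set ((X × X) × I)) :=
    isClosed_singleton.preimage continuous_snd
  have h1 : IsClosed (Prod.snd ⁻¹' {1} : Set ((X × X) × I)) :=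
    isClosed_singleton.preimage continuous_snd
  have hc := (hcK.union_of_isClosed hc0 hK' h0).union_of_isClosed hc1 (hK'.union h0) h1
  obtain ⟨ψ, hψ⟩ := ContinuousMap.exists_restrict_eq ((hK'.union h0).union h1)
    ⟨_, continuousOn_iff_continuous_domRestrict.1 hc⟩
  have hψφ {q : (X × X) × I}
      (hq : q ∈ (Prod.fst ⁻¹' K ∪ Prod.snd ⁻¹' {0}) ∪ Prod.snd ⁻¹' {1}) : ψ q = φ q :=
    DFunLike.congr_fun hψ ⟨q, hq⟩
  let ε : (X × X) × I → (κ → ℝ) × (κ → ℝ) × ℝ := fun q => (q.1.1, q.1.2, q.2)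
  have hε : Topology.IsClosedEmbedding ε := by
    refine Continuous.isClosedEmbedding ?_ ?_
    · exact (hcoe.comp (continuous_fst.comp continuous_fst)).prodMk
        ((hcoe.comp (continuous_snd.comp continuous_fst)).prodMk
          (continuous_subtype_val.comp continuous_snd))
    · rintro ⟨⟨x, y⟩, t⟩ ⟨⟨x', y'⟩, t'⟩ h
      simp only [ε, Prod.mk.injEq] at h
      obtain ⟨h1, h2, h3⟩ := h
      have e1 : x = x' := Subtype.ext (WithLp.ofLp_injective 2 h1)
      have e2 : y = y' := Subtype.ext (WithLp.ofLp_injective 2 h2)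
      have e3 : t = t' := Subtype.ext h3
      rw [e1, e2, e3]
  obtain ⟨g, hg⟩ := ContinuousMap.exists_extension' hε ψ
  have hgψ (q : X × X) (t : I) :
      g ((q.1 : EuclideanSpace ℝ κ), (q.2 : EuclideanSpace ℝ κ), (t : ℝ)) = ψ (q, t) :=
    congrFun hg (q, t)
  refine ⟨fun x y t => g (x, y, t), g.continuous, fun q => ⟨?_, ?_, fun hq t ht h => ?_⟩⟩
  · exact (hgψ q 0).trans ((hψφ (by simp)).trans (hφ0 q))
  · exact (hgψ q 1).trans ((hψφ (by simp)).trans (hφ1 q))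
  · have h' := hgψ q ⟨t, ht⟩
    rw [hψφ (.inl (.inl hq)), hφU ⟨q, hKU hq⟩] at h'
    have hz : ((s ⟨q, hKU hq⟩ ⟨t, ht⟩ : X) : EuclideanSpace ℝ κ) = 0 :=
      WithLp.ofLp_injective 2 (h'.symm.trans h)
    exact hX0 (hz ▸ Subtype.coe_prop _)

theorem not_cover_two [DecidableEq κ] {A : (κ → ℝ) →ₗ[ℝ] κ → ℝ} {e : κ}
    (hskew : ∀ x, ∑ i, A x i * x i = 0) (he : A (Pi.single e 1) = 0)
    (hker : ∀ x, A x = 0 → ∀ i ≠ e, x i = 0) :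
    ¬ TCCover (Metric.sphere (0 : EuclideanSpace ℝ κ) 1) 1 := by
  rintro ⟨U, hUo, hUc, hU⟩
  obtain ⟨K, hKc, hKo, hKU⟩ := exists_iUnion_eq_closed_subset hUo (fun _ => Set.toFinite _) hUc
  choose s hs using hU
  choose F hF hF' using fun i => exists_extension_of_section (isCompact_sphere 0 1)
    (by simp) (hKo i) (hKU i) (s i) (hs i)
  have hsph {x : κ → ℝ} (hx : ∑ i, x i ^ 2 = 1) :
      WithLp.toLp 2 x ∈ Metric.sphere (0 : EuclideanSpace ℝ κ) 1 := by
    rw [mem_sphere_zero_iff_norm, EuclideanSpace.norm_eq]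
    simp [hx]
  obtain ⟨x, y, t₀, t₁, hx, hy, h₀, h₁, h₀', h₁'⟩ := exists_common_zero hskew he hker (hF 0) (hF 1)
    (fun x y hx hy => (hF' 0 (⟨_, hsph hx⟩, ⟨_, hsph hy⟩)).1)
    (fun x y hx hy => (hF' 0 (⟨_, hsph hx⟩, ⟨_, hsph hy⟩)).2.1)
    (fun x y hx hy => (hF' 1 (⟨_, hsph hx⟩, ⟨_, hsph hy⟩)).1)
    (fun x y hx hy => (hF' 1 (⟨_, hsph hx⟩, ⟨_, hsph hy⟩)).2.1)
  have hq : (⟨_, hsph hx⟩, ⟨_, hsph hy⟩) ∈ ⋃ i, K i := hKc ▸ Set.mem_univ _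
  obtain ⟨i, hi⟩ := Set.mem_iUnion.1 hq
  fin_cases i
  · exact (hF' 0 _).2.2 hi t₀ h₀ h₀'
  · exact (hF' 1 _).2.2 hi t₁ h₁ h₁'

end LowerBound

theorem TCCover.succ {X : Type*} [TopologicalSpace X] {k : ℕ} (h : TCCover X k) :
    TCCover X (k + 1) := by
  obtain ⟨U, hUo, hUc, hU⟩ := h
  refine ⟨Fin.cons (U 0) U, Fin.cases (hUo 0) hUo, ?_, Fin.cases (hU 0) hU⟩
  refine Set.eq_univ_of_univ_subset (hUc.symm.subset.trans ?_)
  exact Set.iUnion_subset fun i => Set.subset_iUnion_of_subset i.succ (by simp)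

theorem EqTCCover.tcCover {G X : Type*} [Group G] [TopologicalSpace X] [MulAction G X] {k : ℕ}
    (h : EqTCCover G X k) : TCCover X k := by
  obtain ⟨U, hUo, hUc, -, hU⟩ := h
  exact ⟨U, hUo, hUc, fun i => (hU i).imp fun s hs => hs.1⟩

theorem exists_skew_map {n : ℕ} (hn : Even n) :
    ∃ A : (Fin (n + 1) → ℝ) →ₗ[ℝ] Fin (n + 1) → ℝ, (∀ x, ∑ i, A x i * x i = 0) ∧
      A (Pi.single (Fin.last n) 1) = 0 ∧ ∀ x, A x = 0 → ∀ i ≠ Fin.last n, x i = 0 := by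
  obtain ⟨m, rfl⟩ := hn
  let τ : Fin (m + m + 1) → Fin (m + m + 1) := fun i =>
    if h : i = Fin.last _ then i else if (i : ℕ) % 2 = 0 then
      ⟨i + 1, by have := Fin.val_lt_last h; omega⟩ else ⟨i - 1, by omega⟩
  let ε : Fin (m + m + 1) → ℝ := fun i =>
    if i = Fin.last _ then 0 else if (i : ℕ) % 2 = 0 then -1 else 1
  have hlast (i : Fin (m + m + 1)) : i = Fin.last _ ↔ (i : ℕ) = m + m := Fin.ext_iff
  have hτ : Function.Involutive τ := fun i => by
    simp only [τ, hlast]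
    split_ifs <;> simp_all [Fin.ext_iff] <;> omega
  have hε (i : Fin (m + m + 1)) : ε (τ i) = -ε i := by
    simp only [ε, τ, hlast]
    split_ifs <;> simp_all <;> omega
  have hε0 (i : Fin (m + m + 1)) (h : ε i = 0) : i = Fin.last _ := by
    by_contra hi
    simp only [ε, hi, if_false] at h
    split_ifs at h <;> norm_num at h
  have hτl : τ (Fin.last _) = Fin.last _ := by simp [τ]
  refine ⟨LinearMap.pi fun i => ε i • LinearMap.proj (τ i), fun x => ?_, ?_, fun x hx i hi => ?_⟩
  · have h := Equiv.sum_comp hτ.toPerm fun i => ε i * x (τ i) * x i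
    simp only [Function.Involutive.coe_toPerm, hε, hτ _] at h
    have h' : ∑ i, -ε i * x i * x (τ i) = -∑ i, ε i * x (τ i) * x i := by
      rw [← Finset.sum_neg_distrib]
      exact Finset.sum_congr rfl fun i _ => by ring
    rw [h'] at h
    simp only [LinearMap.pi_apply, LinearMap.smul_apply, LinearMap.proj_apply, smul_eq_mul]
    linarith
  · ext i
    by_cases hi : i = Fin.last _
    · simp [hi, ε]
    · have : τ i ≠ Fin.last _ := fun h => hi (by rw [← hτ i, h, hτl])
      simp [this]
  · have h := congrFun hx (τ i)
    simp only [LinearMap.pi_apply, LinearMap.smul_apply, LinearMap.proj_apply, smul_eq_mul, hε,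
      hτ i, Pi.zero_apply, mul_eq_zero, neg_eq_zero] at h
    exact h.resolve_left fun h0 => hi (hε0 i h0)

section UpperBound

variable {E : Type*} [NormedAddCommGroup E] [InnerProductSpace ℝ E]

theorem bentLine_zero_map_ne_zero {x y : E} (hx : ‖x‖ = 1) (hy : ‖y‖ = 1) (hxy : y ≠ -x) {t : ℝ}
    (ht : t ∈ I) : bentLine 0 x y t ≠ 0 := by
  intro h
  have h1 : (1 - t) • x = -(t • y) := by
    simpa [bentLine, eq_neg_iff_add_eq_zero] using h
  have h2 := congrArg norm h1
  rw [norm_neg, norm_smul, norm_smul, hx, hy, Real.norm_of_nonneg (by linarith [ht.2]),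
    Real.norm_of_nonneg ht.1] at h2
  have h3 : t = 1 / 2 := by linarith
  subst h3
  refine hxy (smul_right_injective E (r := (1 / 2 : ℝ)) (by norm_num) ?_)
  norm_num at h1 ⊢
  rw [h1, neg_neg]

theorem bentLine_neg_ne_zero {A : E →ₗ[ℝ] E} {x : E} (hx : ‖x‖ = 1) (hA : inner ℝ x (A x) = 0)
    (hAx : A x ≠ 0) (t : ℝ) : bentLine A x (-x) t ≠ 0 := by
  intro h
  have h1 := congrArg (inner ℝ x) h
  simp only [bentLine, inner_add_right, inner_smul_right, inner_neg_right, hA, inner_zero_right,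
    real_inner_self_eq_norm_sq, hx] at h1
  have h2 : t = 1 / 2 := by linarith
  subst h2
  have h3 : (1 / 4 : ℝ) • A x = 0 := by
    rw [← h, bentLine]
    module
  exact hAx ((smul_eq_zero.1 h3).resolve_left (by norm_num))

end UpperBound

section Antipodal

variable {n : ℕ}

local notation "V" => EuclideanSpace ℝ (Fin (n + 1))
local notation "X" => Metric.sphere (0 : EuclideanSpace ℝ (Fin (n + 1))) 1

theorem coe_antipodal_smul (g : ℤˣ) (x : X) : ((g • x : X) : V) = ((g : ℤ) : ℝ) • (x : V) :=
  rfl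

/-- The pairs of points that are joined on the sphere by a normalized bent line. -/
def bentSet (A : V →ₗ[ℝ] V) : Set (X × X) :=
  {p | ∀ t : I, bentLine A (p.1 : V) p.2 t ≠ 0}

theorem continuous_bentLine {α : Type*} [TopologicalSpace α] (A : V →ₗ[ℝ] V) {f g : α → V}
    {h : α → ℝ} (hf : Continuous f) (hg : Continuous g) (hh : Continuous h) :
    Continuous fun a => bentLine A (f a) (g a) (h a) := by
  have := A.continuous_of_finiteDimensional
  unfold bentLine
  fun_prop

theorem isOpen_bentSet (A : V →ₗ[ℝ] V) : IsOpen (bentSet A) := by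
  have h : IsClosed {q : (X × X) × I | bentLine A (q.1.1 : V) q.1.2 q.2 = 0} :=
    isClosed_eq (continuous_bentLine A (by fun_prop) (by fun_prop) (by fun_prop))
      continuous_const
  convert! (isClosedMap_fst_of_compactSpace _ h).isOpen_compl using 1
  ext p
  simp [bentSet]

theorem smul_mem_bentSet {A : V →ₗ[ℝ] V} (g : ℤˣ) {p : X × X} (hp : p ∈ bentSet A) :
    g • p ∈ bentSet A := fun t => by
  rw [Prod.smul_fst, Prod.smul_snd, coe_antipodal_smul, coe_antipodal_smul, bentLine_smul]
  exact smul_ne_zero (by simp) (hp t)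

theorem continuous_bentLine_bentSet (A : V →ₗ[ℝ] V) :
    Continuous fun q : bentSet A × I => bentLine A (q.1.1.1 : V) q.1.1.2 q.2 :=
  continuous_bentLine A (by fun_prop) (by fun_prop) (by fun_prop)

/-- The normalized bent lines. -/
def bentSection (A : V →ₗ[ℝ] V) : C(bentSet A, C(I, X)) :=
  ContinuousMap.curry
    { toFun := fun q => ⟨‖bentLine A (q.1.1.1 : V) q.1.1.2 q.2‖⁻¹ •
          bentLine A (q.1.1.1 : V) q.1.1.2 q.2,
        mem_sphere_zero_iff_norm.2 (by
          rw [norm_smul, norm_inv, norm_norm, inv_mul_cancel₀ (norm_ne_zero_iff.2 (q.1.2 q.2))])⟩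
      continuous_toFun := Continuous.subtype_mk
        (((continuous_bentLine_bentSet A).norm.inv₀ fun q => norm_ne_zero_iff.2 (q.1.2 q.2)).smul
          (continuous_bentLine_bentSet A)) _ }

theorem coe_bentSection (A : V →ₗ[ℝ] V) (p : bentSet A) (t : I) :
    (bentSection A p t : V) =
      ‖bentLine A (p.1.1 : V) p.1.2 t‖⁻¹ • bentLine A (p.1.1 : V) p.1.2 t :=
  rfl

theorem pathEval_bentSection (A : V →ₗ[ℝ] V) (p : bentSet A) :
    pathEval X (bentSection A p) = p := by
  refine Prod.ext (Subtype.ext ?_) (Subtype.ext ?_)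
  · simp [pathEval, coe_bentSection, bentLine_zero]
  · simp [pathEval, coe_bentSection, bentLine_one]

theorem bentSection_smul (A : V →ₗ[ℝ] V) (g : ℤˣ) (p : bentSet A)
    (hg : g • (p : X × X) ∈ bentSet A) (t : I) :
    bentSection A ⟨g • (p : X × X), hg⟩ t = g • bentSection A p t := by
  have hn : |((g : ℤ) : ℝ)| = 1 := by
    rcases Int.units_eq_one_or g with h | h <;> simp [h]
  refine Subtype.ext ?_
  simp only [coe_antipodal_smul, coe_bentSection, Prod.smul_fst, Prod.smul_snd, bentLine_smul,
    norm_smul, Real.norm_eq_abs, hn, one_mul]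
  exact smul_comm _ _ _

theorem eqTCCover_of_bentSet {k : ℕ} (A : Fin (k + 1) → V →ₗ[ℝ] V)
    (hA : ∀ p : X × X, ∃ i, p ∈ bentSet (A i)) : EqTCCover ℤˣ X k :=
  ⟨fun i => bentSet (A i), fun _ => isOpen_bentSet _, Set.eq_univ_of_forall fun p =>
    Set.mem_iUnion.2 (hA p), fun _ g _ hp => smul_mem_bentSet g hp,
    fun i => ⟨bentSection (A i), pathEval_bentSection _, bentSection_smul _⟩⟩

theorem eqTCCover_two (hn : 2 ≤ n) (heven : Even n) : EqTCCover ℤˣ X 2 := by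
  obtain ⟨A, hskew, -, hker⟩ := exists_skew_map heven
  let A₁ : V →ₗ[ℝ] V := (WithLp.linearEquiv 2 ℝ (Fin (n + 1) → ℝ)).symm.conj A
  have hA₁ (v : V) (i : Fin (n + 1)) : A₁ v i = A v i := rfl
  let A₂ : V →ₗ[ℝ] V :=
    (EuclideanSpace.projₗ (Fin.last n)).smulRight (EuclideanSpace.single 0 (1 : ℝ))
  have h0 : (0 : Fin (n + 1)) ≠ Fin.last n := by
    rw [Ne, Fin.ext_iff]
    simp
    omega
  refine eqTCCover_of_bentSet ![0, A₁, A₂] ?_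
  rintro ⟨x, y⟩
  have hx : ‖(x : V)‖ = 1 := mem_sphere_zero_iff_norm.1 x.2
  have hy : ‖(y : V)‖ = 1 := mem_sphere_zero_iff_norm.1 y.2
  by_cases hxy : (y : V) = -x
  · by_cases hAx : A₁ x = 0
    · refine ⟨2, fun t => ?_⟩
      have hxi : ∀ i ≠ Fin.last n, (x : V) i = 0 := hker _ (funext fun i => by
        rw [← hA₁, hAx]; rfl)
      change bentLine A₂ (x : V) y t ≠ 0
      rw [hxy]
      refine bentLine_neg_ne_zero hx ?_ ?_ t
      · simp [A₂, inner_smul_right, EuclideanSpace.inner_single_right, hxi 0 h0]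
      · intro h
        have h1 := congrArg (fun v : V => v 0) h
        have h2 : (x : V) (Fin.last n) = 0 := by simpa [A₂] using h1
        have h3 : (x : V) = 0 := by
          ext i
          by_cases hi : i = Fin.last n
          · rw [hi, h2]; rfl
          · rw [hxi i hi]; rfl
        rw [h3, norm_zero] at hx
        exact zero_ne_one hx
    · refine ⟨1, fun t => ?_⟩
      change bentLine A₁ (x : V) y t ≠ 0
      rw [hxy]
      refine bentLine_neg_ne_zero hx ?_ hAx t
      simpa [PiLp.inner_apply, hA₁] using hskew x
  · exact ⟨0, fun t => bentLine_zero_map_ne_zero hx hy hxy t.2⟩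

end Antipodal

/-- Let `G = ℤ/2` act antipodally on the sphere `Sⁿ` with `n ≥ 2` even. Then the
(reduced) equivariant topological complexity `TC_G(Sⁿ)` equals `2`. -/
theorem stmt5 (n : ℕ) (hn : 2 ≤ n) (heven : Even n) :
    eqTC ℤˣ (Metric.sphere (0 : EuclideanSpace ℝ (Fin (n + 1))) 1) = 2 := by
  obtain ⟨A, hskew, he, hker⟩ := exists_skew_map heven
  have hone := not_cover_two hskew he hker
  refine le_antisymm (sInf_le ⟨2, eqTCCover_two hn heven, rfl⟩) (le_sInf ?_)
  rintro _ ⟨k, hk, rfl⟩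
  by_contra! hlt
  have hk2 : k < 2 := by exact_mod_cast hlt
  interval_cases k
  · exact hone hk.tcCover.succ
  · exact hone hk.tcCover

end
end
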